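/- arXiv:1809.08943 — 2 statements merged into one kernel-verified Lean document; each statement's English description precedes it below -/
import Mathlib

section
/- Fix t ≥ 1 and let K ∈ M(t). Then the set C(K) has at most 6 elements; since C(K) is symmetric with an even number of elements containing {±e₁/‖±e₁‖_{K*}}, this means |C(K)| = 4 or |C(K)| = 6. -/
open MeasureTheory
open scoped RealInnerProductSpace Pointwise

noncomputable section

/-- Euclidean `n`-space. -/
abbrev E (n : ℕ) := EuclideanSpace ℝ (Fin n)

/-- A convex body: a compact convex set with nonempty interior. -/
def IsConvexBody {n : ℕ} (K : Set (E n)) : Prop :=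
  Convex ℝ K ∧ IsCompact K ∧ (interior K).Nonempty

/-- Central symmetral `cs K = (1/2)(K - K)`. -/
def csBody {n : ℕ} (K : Set (E n)) : Set (E n) := (2⁻¹ : ℝ) • (K - K)

/-- Polar body `L* = {y : ⟨x, y⟩ ≤ 1 for all x ∈ L}`. -/
def polarBody {n : ℕ} (L : Set (E n)) : Set (E n) :=
  {y | ∀ x ∈ L, ⟪x, y⟫ ≤ 1}

/-- A point of the integer lattice `ℤⁿ ⊆ ℝⁿ`. -/
def isLatticePoint {n : ℕ} (z : E n) : Prop := ∀ j, ∃ m : ℤ, z j = (m : ℝ)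

/-- The `i`-th successive minimum of `L` with respect to the lattice `ℤⁿ`:
the least `λ > 0` such that `λ • L` contains `i` linearly independent lattice points. -/
def succMin {n : ℕ} (L : Set (E n)) (i : ℕ) : ℝ :=
  sInf {lam : ℝ | 0 < lam ∧ ∃ v : Fin i → E n,
    LinearIndependent ℝ v ∧ ∀ j, isLatticePoint (v j) ∧ v j ∈ lam • L}

/-- The first standard unit vector in `ℝ²`. -/
def e1 : E 2 := EuclideanSpace.single 0 1

/-- The second standard unit vector in `ℝ²`. -/
def e2 : E 2 := EuclideanSpace.single 1 1

/-- The class `A(t)` of convex bodies `K ⊆ ℝ²` with `0 ∈ int K`,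
`λ₁((cs K)*) = 1/t`, `λ₂((cs K)*) = 1`, and `eᵢ ∈ λᵢ((cs K)*) • (cs K)*`. -/
def Aclass (t : ℝ) : Set (Set (E 2)) :=
  {K | IsConvexBody K ∧ (0 : E 2) ∈ interior K ∧
    succMin (polarBody (csBody K)) 1 = 1 / t ∧
    succMin (polarBody (csBody K)) 2 = 1 ∧
    e1 ∈ succMin (polarBody (csBody K)) 1 • polarBody (csBody K) ∧
    e2 ∈ succMin (polarBody (csBody K)) 2 • polarBody (csBody K)}

/-- The set `M(t)` of area minimizers in `A(t)`. -/
def Mclass (t : ℝ) : Set (Set (E 2)) :=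
  {M | M ∈ Aclass t ∧ ∀ K ∈ Aclass t, volume M ≤ volume K}

/-- `C₀(K) = {z ∈ ℤ² : ‖z‖_{(cs K)*} = 1} ∪ {±e₁}`. -/
def C0 (K : Set (E 2)) : Set (E 2) :=
  {z | isLatticePoint z ∧ gauge (polarBody (csBody K)) z = 1} ∪ {e1, -e1}

/-- `C(K) = {z / ‖z‖_{K*} : z ∈ C₀(K)}`. -/
def Cset (K : Set (E 2)) : Set (E 2) :=
  (fun z => (gauge (polarBody K) z)⁻¹ • z) '' C0 K

/-- `F` is an edge (one-dimensional face) of the convex set `C`. -/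
def IsEdge (C F : Set (E 2)) : Prop :=
  IsExtreme ℝ C F ∧ Module.finrank ℝ (vectorSpan ℝ F) = 1

lemma isGreatest_gauge_polarBody {n : ℕ} {S : Set (E n)} (hS : IsCompact S) (h0 : (0 : E n) ∈ S)
    (z : E n) : IsGreatest ((fun x => ⟪x, z⟫) '' S) (gauge (polarBody S) z) := by
  obtain ⟨x, hx, hmax⟩ := hS.exists_isMaxOn ⟨0, h0⟩
    (f := fun x => ⟪x, z⟫) (by fun_prop)
  have hx0 : 0 ≤ ⟪x, z⟫ := by simpa using hmax h0
  have hmem : ∀ r : ℝ, 0 < r → (z ∈ r • polarBody S ↔ ⟪x, z⟫ ≤ r) := by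
    intro r hr
    rw [Set.mem_smul_set_iff_inv_smul_mem₀ hr.ne']
    simp only [polarBody, Set.mem_ofPred_eq, inner_smul_right, inv_mul_le_iff₀ hr, mul_one]
    exact ⟨fun h => h x hx, fun h y hy => (hmax hy).trans h⟩
  have hg : gauge (polarBody S) z = ⟪x, z⟫ := by
    refine csInf_eq_of_forall_ge_of_forall_gt_exists_lt ?_ ?_ ?_
    · exact ⟨⟪x, z⟫ + 1, by positivity, (hmem _ (by positivity)).2 (by linarith)⟩
    · rintro r ⟨hr, hz⟩
      exact (hmem r hr).1 hz
    · intro r hr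
      obtain ⟨s, hs, hsr⟩ := exists_between hr
      exact ⟨s, ⟨hx0.trans_lt hs, (hmem s (hx0.trans_lt hs)).2 hs.le⟩, hsr⟩
  rw [hg]
  exact ⟨⟨x, hx, rfl⟩, by rintro _ ⟨y, hy, rfl⟩; exact hmax hy⟩

lemma mem_smul_polarBody_iff {n : ℕ} {S : Set (E n)} (hS : IsCompact S) (h0 : (0 : E n) ∈ S)
    {r : ℝ} (hr : 0 < r) (z : E n) : z ∈ r • polarBody S ↔ gauge (polarBody S) z ≤ r := by
  obtain ⟨⟨x, hx, hxz⟩, hmax⟩ := isGreatest_gauge_polarBody hS h0 z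
  rw [Set.mem_smul_set_iff_inv_smul_mem₀ hr.ne', ← hxz]
  simp only [polarBody, Set.mem_ofPred_eq, inner_smul_right, inv_mul_le_iff₀ hr, mul_one]
  exact ⟨fun h => h x hx, fun h y hy => ((hmax ⟨y, hy, rfl⟩).trans hxz.ge).trans h⟩

lemma isCompact_csBody {n : ℕ} {K : Set (E n)} (hK : IsCompact K) : IsCompact (csBody K) := by
  rw [csBody, sub_eq_add_neg]
  exact (hK.add hK.neg).smul _

lemma zero_mem_csBody {n : ℕ} {K : Set (E n)} (hK : K.Nonempty) : (0 : E n) ∈ csBody K := by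
  obtain ⟨x, hx⟩ := hK
  exact ⟨0, ⟨x, hx, x, hx, sub_self x⟩, smul_zero _⟩

/-- Half the width of `K` in direction `z`, written as the gauge of the polar symmetral. -/
def halfWidth {n : ℕ} (K : Set (E n)) (z : E n) : ℝ := gauge (polarBody (csBody K)) z

lemma inner_sub_le_halfWidth {n : ℕ} {K : Set (E n)} (hK : IsCompact K) {x y : E n}
    (hx : x ∈ K) (hy : y ∈ K) (z : E n) : ⟪x - y, z⟫ ≤ 2 * halfWidth K z := by
  have h := (isGreatest_gauge_polarBody (isCompact_csBody hK) (zero_mem_csBody ⟨x, hx⟩) z).2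
    ⟨_, ⟨x - y, ⟨x, hx, y, hy, rfl⟩, rfl⟩, rfl⟩
  simp only [real_inner_smul_left] at h
  unfold halfWidth
  linarith

lemma exists_inner_sub_eq_halfWidth {n : ℕ} {K : Set (E n)} (hK : IsCompact K)
    (hne : K.Nonempty) (z : E n) : ∃ x ∈ K, ∃ y ∈ K, ⟪x - y, z⟫ = 2 * halfWidth K z := by
  obtain ⟨_, ⟨_, ⟨x, hx, y, hy, rfl⟩, rfl⟩, h⟩ :=
    (isGreatest_gauge_polarBody (isCompact_csBody hK) (zero_mem_csBody hne) z).1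
  refine ⟨x, hx, y, hy, ?_⟩
  simp only [real_inner_smul_left] at h
  unfold halfWidth
  linarith

lemma halfWidth_neg {n : ℕ} {K : Set (E n)} (hK : IsCompact K) (hne : K.Nonempty) (z : E n) :
    halfWidth K (-z) = halfWidth K z := by
  have key : ∀ z : E n, halfWidth K (-z) ≤ halfWidth K z := by
    intro z
    obtain ⟨x, hx, y, hy, h⟩ := exists_inner_sub_eq_halfWidth hK hne (-z)
    have h' := inner_sub_le_halfWidth hK hy hx z
    rw [inner_neg_right, ← inner_neg_left, neg_sub] at h
    linarith
  exact (key z).antisymm (by simpa using key (-z))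

lemma halfWidth_add_le {n : ℕ} {K : Set (E n)} (hK : IsCompact K) (hne : K.Nonempty)
    (y z : E n) : halfWidth K (y + z) ≤ halfWidth K y + halfWidth K z := by
  obtain ⟨a, ha, b, hb, h⟩ := exists_inner_sub_eq_halfWidth hK hne (y + z)
  have h1 := inner_sub_le_halfWidth hK ha hb y
  have h2 := inner_sub_le_halfWidth hK ha hb z
  rw [inner_add_right] at h
  linarith

lemma halfWidth_smul {n : ℕ} {K : Set (E n)} (hK : IsCompact K) (hne : K.Nonempty)
    (c : ℝ) (z : E n) : halfWidth K (c • z) = |c| * halfWidth K z := by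
  have key : ∀ c : ℝ, 0 ≤ c → halfWidth K (c • z) = c * halfWidth K z := fun c hc =>
    gauge_smul_of_nonneg hc z
  rcases le_total 0 c with hc | hc
  · rw [key c hc, abs_of_nonneg hc]
  · rw [← halfWidth_neg hK hne, ← neg_smul, key _ (neg_nonneg.2 hc), abs_of_nonpos hc]

/-- The vector of the plane with given coordinates. -/
def vec (a b : ℝ) : E 2 := !₂[a, b]

@[simp] lemma vec_zero_coord (a b : ℝ) : vec a b 0 = a := rfl

@[simp] lemma vec_one_coord (a b : ℝ) : vec a b 1 = b := rfl

lemma plane_ext {x y : E 2} (h0 : x 0 = y 0) (h1 : x 1 = y 1) : x = y := by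
  ext i
  fin_cases i <;> assumption

lemma vec_eta (x : E 2) : vec (x 0) (x 1) = x := plane_ext rfl rfl

lemma vec_inj {a b c d : ℝ} : vec a b = vec c d ↔ a = c ∧ b = d :=
  ⟨fun h => ⟨congrArg (fun z : E 2 => z 0) h, congrArg (fun z : E 2 => z 1) h⟩,
    fun ⟨h0, h1⟩ => by rw [h0, h1]⟩

lemma e1_eq : e1 = vec 1 0 := by
  apply plane_ext <;> simp [e1]

lemma e2_eq : e2 = vec 0 1 := by
  apply plane_ext <;> simp [e2]

lemma inner_vec (x : E 2) (a b : ℝ) : ⟪x, vec a b⟫ = x 0 * a + x 1 * b := by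
  simp [PiLp.inner_apply, Fin.sum_univ_two, mul_comm]

lemma vec_add (a b c d : ℝ) : vec a b + vec c d = vec (a + c) (b + d) :=
  plane_ext rfl rfl

lemma smul_vec (c a b : ℝ) : c • vec a b = vec (c * a) (c * b) :=
  plane_ext rfl rfl

lemma neg_vec (a b : ℝ) : -vec a b = vec (-a) (-b) :=
  plane_ext rfl rfl

lemma isLatticePoint_vec (a b : ℤ) : isLatticePoint (vec a b) := by
  intro j
  fin_cases j
  exacts [⟨a, rfl⟩, ⟨b, rfl⟩]

lemma isLatticePoint.exists_vec {z : E 2} (hz : isLatticePoint z) :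
    ∃ a b : ℤ, z = vec a b := by
  obtain ⟨a, ha⟩ := hz 0
  obtain ⟨b, hb⟩ := hz 1
  exact ⟨a, b, plane_ext ha hb⟩

/-- The standard closed triangle. -/
def stdTriangle : Set (E 2) := {x | 0 ≤ x 0 ∧ 0 ≤ x 1 ∧ x 0 + x 1 ≤ 1}

/-- The closed triangle with vertices `a`, `b`, `c`, parametrised by the standard triangle. -/
def triangle (a b c : E 2) : Set (E 2) :=
  (fun x : E 2 => a + (x 0 • (b - a) + x 1 • (c - a))) '' stdTriangle

lemma isCompact_stdTriangle : IsCompact stdTriangle := by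
  refine Metric.isCompact_of_isClosed_isBounded ?_ ?_
  · have h0 : Continuous fun x : E 2 => x 0 := by fun_prop
    have h1 : Continuous fun x : E 2 => x 1 := by fun_prop
    exact (isClosed_le continuous_const h0).inter
      ((isClosed_le continuous_const h1).inter (isClosed_le (h0.add h1) continuous_const))
  · refine (Metric.isBounded_closedBall (x := (0 : E 2)) (r := 2)).subset ?_
    rintro x ⟨h0, h1, h2⟩
    rw [mem_closedBall_zero_iff, EuclideanSpace.norm_eq, Real.sqrt_le_left (by norm_num)]
    simp only [Fin.sum_univ_two, Real.norm_eq_abs, sq_abs]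
    nlinarith

lemma volume_stdTriangle_pos : 0 < volume stdTriangle := by
  have h0 : Continuous fun x : E 2 => x 0 := by fun_prop
  have h1 : Continuous fun x : E 2 => x 1 := by fun_prop
  have ho : IsOpen {x : E 2 | 0 < x 0 ∧ 0 < x 1 ∧ x 0 + x 1 < 1} :=
    (isOpen_lt continuous_const h0).inter
      ((isOpen_lt continuous_const h1).inter (isOpen_lt (h0.add h1) continuous_const))
  refine (ho.measure_pos volume ⟨vec (1 / 3) (1 / 3), ?_⟩).trans_le (measure_mono ?_)
  · simp only [Set.mem_ofPred_eq, vec_zero_coord, vec_one_coord]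
    norm_num
  · rintro x ⟨hx0, hx1, hx⟩
    exact ⟨hx0.le, hx1.le, hx.le⟩

lemma isCompact_triangle (a b c : E 2) : IsCompact (triangle a b c) :=
  isCompact_stdTriangle.image (by fun_prop)

lemma convex_triangle (a b c : E 2) : Convex ℝ (triangle a b c) := by
  rintro _ ⟨x, ⟨hx0, hx1, hx⟩, rfl⟩ _ ⟨y, ⟨hy0, hy1, hy⟩, rfl⟩ r s hr hs hrs
  refine ⟨r • x + s • y, ⟨?_, ?_, ?_⟩, ?_⟩
  · simp only [PiLp.add_apply, PiLp.smul_apply, smul_eq_mul]; positivity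
  · simp only [PiLp.add_apply, PiLp.smul_apply, smul_eq_mul]; positivity
  · simp only [PiLp.add_apply, PiLp.smul_apply, smul_eq_mul]; nlinarith
  · obtain rfl : s = 1 - r := by linarith
    simp only [PiLp.add_apply, PiLp.smul_apply, smul_eq_mul]
    module

lemma triangle_subset {K : Set (E 2)} (hK : Convex ℝ K) {a b c : E 2} (ha : a ∈ K) (hb : b ∈ K)
    (hc : c ∈ K) : triangle a b c ⊆ K := by
  rintro _ ⟨x, ⟨h0, h1, h⟩, rfl⟩
  have hmem := hK.sum_mem (t := Finset.univ) (w := ![1 - x 0 - x 1, x 0, x 1]) (z := ![a, b, c])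
    (by intro i _; fin_cases i <;> simp <;> linarith)
    (by simp [Fin.sum_univ_three]; ring)
    (by intro i _; fin_cases i <;> simpa)
  convert hmem using 1
  simp [Fin.sum_univ_three]
  module

lemma volume_triangle (a b c : E 2) : volume (triangle a b c) =
    ENNReal.ofReal |(b - a) 0 * (c - a) 1 - (b - a) 1 * (c - a) 0| * volume stdTriangle := by
  let B := (EuclideanSpace.basisFun (Fin 2) ℝ).toBasis
  let f : E 2 →ₗ[ℝ] E 2 := Matrix.toLin B B !![(b - a) 0, (c - a) 0; (b - a) 1, (c - a) 1]
  have hf : ∀ x : E 2, f x = x 0 • (b - a) + x 1 • (c - a) := by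
    intro x
    apply plane_ext <;>
    simp [f, B, Matrix.toLin_apply, Fin.sum_univ_two, Matrix.mulVec, dotProduct] <;> ring
  have himg : triangle a b c = (fun y => a + y) '' (f '' stdTriangle) := by
    rw [Set.image_image]
    simp only [triangle, hf]
  rw [himg, Set.image_add_left, measure_preimage_add, Measure.addHaar_image_linearMap]
  simp only [f, LinearMap.det_toLin, Matrix.det_fin_two_of]
  congr 3
  ring

lemma volume_setOf_inner_eq {p : E 2} (hp : p ≠ 0) (r : ℝ) :
    volume {x : E 2 | ⟪x, p⟫ = r} = 0 := by
  have hker : {x : E 2 | ⟪x, p⟫ = r} =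
      (AffineSubspace.comap (innerₛₗ ℝ p).toAffineMap
        (AffineSubspace.mk' r (⊥ : Submodule ℝ ℝ)) : Set (E 2)) := by
    ext x
    simp [real_inner_comm, sub_eq_zero]
  rw [hker]
  refine Measure.addHaar_affineSubspace volume _ fun htop => ?_
  have h : ∀ x : E 2, ⟪x, p⟫ = r := fun x => by
    have hx : x ∈ {x : E 2 | ⟪x, p⟫ = r} := by
      rw [hker, htop]
      exact Set.mem_univ x
    exact hx
  have h0 := h 0
  have h1 := h p
  rw [inner_zero_left] at h0
  rw [← h0] at h1
  exact hp (inner_self_eq_zero.1 h1)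

/-- If `(p, q)` is a basis of the lattice and `q - p`, `q`, `q + p` all have half width `1`, then
the convex body contains a quadrilateral whose diagonal is dual to `q`. -/
lemma le_volume_of_halfWidth_eq_one {K : Set (E 2)} (hconv : Convex ℝ K) (hK : IsCompact K)
    (hne : K.Nonempty) {p q : E 2} (hdet : |p 0 * q 1 - p 1 * q 0| = 1)
    (h0 : halfWidth K q = 1) (h1 : halfWidth K (q + p) ≤ 1) (h2 : halfWidth K (q - p) ≤ 1) :
    ENNReal.ofReal (4 * halfWidth K p) * volume stdTriangle ≤ volume K := by
  obtain ⟨a, ha, b, hb, hab⟩ := exists_inner_sub_eq_halfWidth hK hne q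
  obtain ⟨c, hc, d, hd, hcd⟩ := exists_inner_sub_eq_halfWidth hK hne p
  have hp : p ≠ 0 := by
    rintro rfl
    simp at hdet
  have hip : ∀ x : E 2, ⟪x, p⟫ = x 0 * p 0 + x 1 * p 1 := fun x => by
    rw [← inner_vec, vec_eta]
  have hiq : ⟪a - b, q⟫ = (a - b) 0 * q 0 + (a - b) 1 * q 1 := by
    rw [← inner_vec, vec_eta]
  have habp : ⟪a - b, p⟫ = 0 := by
    have h3 := inner_sub_le_halfWidth hK ha hb (q + p)
    have h4 := inner_sub_le_halfWidth hK ha hb (q - p)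
    rw [inner_add_right] at h3
    rw [inner_sub_right] at h4
    linarith
  have harea : ∀ x : E 2, |(a - b) 0 * (x - b) 1 - (a - b) 1 * (x - b) 0| = 2 * |⟪x - b, p⟫| := by
    intro x
    have e0 : ((a - b) 0 * (x - b) 1 - (a - b) 1 * (x - b) 0) * (p 0 * q 1 - p 1 * q 0) =
        ⟪a - b, p⟫ * ((x - b) 0 * q 0 + (x - b) 1 * q 1) - ⟪a - b, q⟫ * ⟪x - b, p⟫ := by
      rw [hip, hip, hiq]
      ring
    rw [habp, hab, h0, zero_mul, zero_sub] at e0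
    have e1 := congrArg abs e0
    rw [abs_mul, hdet, mul_one, abs_neg, abs_mul] at e1
    simpa using e1
  have hcb : 0 ≤ ⟪c - b, p⟫ := by
    have := inner_sub_le_halfWidth hK hb hd p
    have e : ⟪c - b, p⟫ + ⟪b - d, p⟫ = ⟪c - d, p⟫ := by rw [← inner_add_left]; congr 1; abel
    linarith
  have hdb : ⟪d - b, p⟫ ≤ 0 := by
    have := inner_sub_le_halfWidth hK hc hb p
    have e : ⟪c - b, p⟫ - ⟪d - b, p⟫ = ⟪c - d, p⟫ := by rw [← inner_sub_left]; congr 1; abel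
    linarith
  have hside : ∀ v : E 2, ∀ x ∈ triangle b a v, ∃ s : ℝ, 0 ≤ s ∧
      ⟪x, p⟫ - ⟪b, p⟫ = s * ⟪v - b, p⟫ := by
    rintro v _ ⟨x, hx, rfl⟩
    refine ⟨x 1, hx.2.1, ?_⟩
    rw [inner_add_left, inner_add_left, real_inner_smul_left, real_inner_smul_left, habp]
    ring
  have hdisj : AEDisjoint volume (triangle b a c) (triangle b a d) := by
    refine measure_mono_null ?_ (volume_setOf_inner_eq hp ⟪b, p⟫)
    rintro x ⟨hx, hx'⟩
    obtain ⟨s, hs, hs'⟩ := hside c x hx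
    obtain ⟨r, hr, hr'⟩ := hside d x hx'
    have := mul_nonneg hs hcb
    have := mul_nonpos_of_nonneg_of_nonpos hr hdb
    change ⟪x, p⟫ = ⟪b, p⟫
    linarith
  calc ENNReal.ofReal (4 * halfWidth K p) * volume stdTriangle
      = volume (triangle b a c ∪ triangle b a d) := by
        rw [measure_union₀ (isCompact_triangle b a d).measurableSet.nullMeasurableSet hdisj,
          volume_triangle, volume_triangle, harea, harea, ← add_mul,
          ← ENNReal.ofReal_add (by positivity) (by positivity), abs_of_nonneg hcb,
          abs_of_nonpos hdb]
        congr 2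
        have e : ⟪c - b, p⟫ - ⟪d - b, p⟫ = ⟪c - d, p⟫ := by
          rw [← inner_sub_left]; congr 1; abel
        linarith
    _ ≤ volume K := measure_mono (Set.union_subset (triangle_subset hconv hb ha hc)
        (triangle_subset hconv hb ha hd))

lemma linearIndependent_plane_pair {x y : E 2} (h : x 0 * y 1 - x 1 * y 0 ≠ 0) :
    LinearIndependent ℝ ![x, y] := by
  rw [LinearIndependent.pair_iff]
  intro s r hsr
  have h0 : s * x 0 + r * y 0 = 0 := by simpa using congrArg (fun z : E 2 => z 0) hsr
  have h1 : s * x 1 + r * y 1 = 0 := by simpa using congrArg (fun z : E 2 => z 1) hsr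
  constructor
  · refine (mul_eq_zero.1 (?_ : s * (x 0 * y 1 - x 1 * y 0) = 0)).resolve_right h
    linear_combination y 1 * h0 - y 0 * h1
  · refine (mul_eq_zero.1 (?_ : r * (x 0 * y 1 - x 1 * y 0) = 0)).resolve_right h
    linear_combination x 0 * h1 - x 1 * h0

/-- The conditions defining `Aclass t`, expressed through half widths. -/
lemma mem_Aclass_of_halfWidth {t : ℝ} (ht : 1 ≤ t) {K : Set (E 2)} (hK : IsConvexBody K)
    (h0 : (0 : E 2) ∈ interior K) (h1 : halfWidth K e1 = 1 / t) (h2 : halfWidth K e2 = 1)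
    (h : ∀ z, isLatticePoint z → z 1 ≠ 0 → 1 ≤ halfWidth K z) : K ∈ Aclass t := by
  have hne : K.Nonempty := ⟨0, interior_subset h0⟩
  have ht0 : 0 < t := by linarith
  have hmem : ∀ {r : ℝ}, 0 < r → ∀ z, z ∈ r • polarBody (csBody K) ↔ halfWidth K z ≤ r :=
    fun hr z => mem_smul_polarBody_iff (isCompact_csBody hK.2.1) (zero_mem_csBody hne) hr z
  have hle : 1 / t ≤ 1 := by rw [div_le_one ht0]; exact ht
  have l1 : isLatticePoint e1 := by simpa [e1_eq] using isLatticePoint_vec 1 0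
  have l2 : isLatticePoint e2 := by simpa [e2_eq] using isLatticePoint_vec 0 1
  have s1 : succMin (polarBody (csBody K)) 1 = 1 / t := by
    refine IsLeast.csInf_eq ⟨⟨by positivity, fun _ => e1, ?_, fun _ => ⟨l1, ?_⟩⟩, ?_⟩
    · refine LinearIndependent.of_subsingleton 0 fun he => ?_
      have := congrArg (fun z : E 2 => z 0) he
      simp [e1_eq] at this
    · exact (hmem (by positivity) _).2 h1.le
    · rintro r ⟨hr, v, hv, hvr⟩
      obtain ⟨hl, hv'⟩ := hvr 0
      rw [hmem hr] at hv'
      by_cases hz : v 0 1 = 0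
      · obtain ⟨a, b, hab⟩ := hl.exists_vec
        have hb : (b : ℝ) = 0 := by simpa [hab] using hz
        have ha : a ≠ 0 := by
          rintro rfl
          refine hv.ne_zero 0 ?_
          rw [hab, hb]
          apply plane_ext <;> simp
        have hae : vec a b = (a : ℝ) • e1 := by rw [e1_eq, smul_vec, hb, mul_one, mul_zero]
        rw [hab, hae, halfWidth_smul hK.2.1 hne, h1] at hv'
        have : (1 : ℝ) ≤ |(a : ℝ)| := by exact_mod_cast Int.one_le_abs ha
        have hpos : 0 < 1 / t := by positivity
        nlinarith
      · exact (hle.trans (h _ hl hz)).trans hv'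
  have s2 : succMin (polarBody (csBody K)) 2 = 1 := by
    refine IsLeast.csInf_eq ⟨⟨one_pos, ![e1, e2], ?_, ?_⟩, ?_⟩
    · apply linearIndependent_plane_pair
      simp [e1_eq, e2_eq]
    · intro j
      fin_cases j
      · exact ⟨l1, (hmem one_pos _).2 (h1.le.trans hle)⟩
      · exact ⟨l2, (hmem one_pos _).2 h2.le⟩
    · rintro r ⟨hr, v, hv, hvr⟩
      by_cases hz : v 0 1 = 0
      · by_cases hz' : v 1 1 = 0
        · exfalso
          have hv2 : LinearIndependent ℝ ![v 0, v 1] := by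
            convert hv using 1
            ext i
            fin_cases i <;> rfl
          rw [LinearIndependent.pair_iff] at hv2
          have := hv2 (v 1 0) (-(v 0 0)) (by apply plane_ext <;> simp [hz, hz']; ring)
          refine hv.ne_zero 1 (plane_ext ?_ hz')
          exact this.1
        · exact (h _ (hvr 1).1 hz').trans ((hmem hr _).1 (hvr 1).2)
      · exact (h _ (hvr 0).1 hz).trans ((hmem hr _).1 (hvr 0).2)
  refine ⟨hK, h0, s1, s2, ?_, ?_⟩
  · rw [s1]
    exact (hmem (by positivity) _).2 h1.le
  · rw [s2]
    exact (hmem one_pos _).2 h2.le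

lemma halfWidth_of_mem_Aclass {t : ℝ} (ht : 1 ≤ t) {K : Set (E 2)} (hK : K ∈ Aclass t) :
    halfWidth K e1 = 1 / t ∧ halfWidth K e2 = 1 ∧
      ∀ z, isLatticePoint z → z 1 ≠ 0 → 1 ≤ halfWidth K z := by
  obtain ⟨hb, h0, s1, s2, m1, m2⟩ := hK
  have hne : K.Nonempty := ⟨0, interior_subset h0⟩
  have ht0 : 0 < t := by linarith
  have hpos : 0 < 1 / t := by positivity
  have hmem : ∀ {r : ℝ}, 0 < r → ∀ z, z ∈ r • polarBody (csBody K) ↔ halfWidth K z ≤ r :=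
    fun hr z => mem_smul_polarBody_iff (isCompact_csBody hb.2.1) (zero_mem_csBody hne) hr z
  have hle : 1 / t ≤ 1 := by rw [div_le_one ht0]; exact ht
  have l1 : isLatticePoint e1 := by simpa [e1_eq] using isLatticePoint_vec 1 0
  have l2 : isLatticePoint e2 := by simpa [e2_eq] using isLatticePoint_vec 0 1
  rw [s1, hmem hpos] at m1
  rw [s2, hmem one_pos] at m2
  have hfirst : ∀ z, isLatticePoint z → z ≠ 0 → 1 / t ≤ halfWidth K z := by
    intro z hz hz0
    by_contra! hlt
    obtain ⟨r, hr, hrt⟩ := exists_between (max_lt hlt hpos)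
    rw [max_lt_iff] at hr
    refine hrt.not_ge (s1.ge.trans (csInf_le ⟨0, fun _ hx => hx.1.le⟩ ?_))
    exact ⟨hr.2, fun _ => z, LinearIndependent.of_subsingleton 0 hz0,
      fun _ => ⟨hz, (hmem hr.2 z).2 hr.1.le⟩⟩
  have hsecond : ∀ z, isLatticePoint z → z 1 ≠ 0 → 1 ≤ halfWidth K z := by
    intro z hz hz1
    by_contra! hlt
    have hz0 : z ≠ 0 := by
      rintro rfl
      exact hz1 rfl
    have ht1 := (hfirst z hz hz0).trans_lt hlt
    refine (max_lt hlt ht1).not_ge (s2.ge.trans (csInf_le ⟨0, fun _ hx => hx.1.le⟩ ?_))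
    have hp : 0 < max (halfWidth K z) (1 / t) := lt_max_of_lt_right hpos
    refine ⟨hp, ![e1, z], linearIndependent_plane_pair (by simpa [e1_eq] using hz1), ?_⟩
    intro j
    fin_cases j
    · exact ⟨l1, (hmem hp _).2 (m1.trans (le_max_right _ _))⟩
    · exact ⟨hz, (hmem hp _).2 (le_max_left _ _)⟩
  refine ⟨m1.antisymm (hfirst _ l1 ?_), m2.antisymm (hsecond _ l2 ?_), hsecond⟩
  · intro he
    have := congrArg (fun z : E 2 => z 0) he
    simp [e1_eq] at this
  · simp [e2_eq]

/-- The competitor triangle in `Aclass u⁻¹`. -/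
def slimTriangle (u : ℝ) : Set (E 2) := triangle (vec 0 1) (vec (-u) (-1)) (vec u (u - 1))

lemma slimTriangle_coords {u : ℝ} {y : E 2} (hy : y ∈ slimTriangle u) :
    ∃ r s : ℝ, 0 ≤ r ∧ 0 ≤ s ∧ r + s ≤ 1 ∧ y 0 = u * (s - r) ∧ y 1 = 1 - 2 * r + (u - 2) * s := by
  obtain ⟨x, ⟨h0, h1, h⟩, rfl⟩ := hy
  refine ⟨x 0, x 1, h0, h1, h, ?_, ?_⟩ <;> simp <;> ring

lemma zero_mem_interior_slimTriangle {u : ℝ} (hu : 0 < u) (hu1 : u ≤ 1) :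
    (0 : E 2) ∈ interior (slimTriangle u) := by
  let f : E 2 → ℝ := fun y => (1 - y 1 - (2 - u) * (y 0 / u)) / (4 - u)
  let g : E 2 → ℝ := fun y => f y + y 0 / u
  have hf : Continuous f := by fun_prop
  have hg : Continuous g := by fun_prop
  have h4 : 0 < 4 - u := by linarith
  rw [mem_interior]
  refine ⟨{y | 0 < f y ∧ 0 < g y ∧ f y + g y < 1}, ?_, ?_, ?_⟩
  · rintro y ⟨h0, h1, h⟩
    refine ⟨vec (f y) (g y), ⟨h0.le, h1.le, h.le⟩, ?_⟩
    apply plane_ext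
    · simp [g]
      field_simp
      ring
    · simp [g, f]
      field_simp
      ring
  · exact (isOpen_lt continuous_const hf).inter
      ((isOpen_lt continuous_const hg).inter (isOpen_lt (hf.add hg) continuous_const))
  · have h2 : (4 - u)⁻¹ + (4 - u)⁻¹ < 1 := by
      rw [← two_mul, ← div_eq_mul_inv, div_lt_one h4]
      linarith
    simpa [f, g] using ⟨by linarith, h2⟩

lemma one_le_halfWidth_slimTriangle {u : ℝ} (hu : 0 < u) (hu1 : u ≤ 1) {z : E 2}
    (hz : isLatticePoint z) (hz1 : z 1 ≠ 0) : 1 ≤ halfWidth (slimTriangle u) z := by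
  have hc : IsCompact (slimTriangle u) := isCompact_triangle _ _ _
  have hne : (slimTriangle u).Nonempty :=
    ⟨0, interior_subset (zero_mem_interior_slimTriangle hu hu1)⟩
  have mA : vec (-u) (-1) ∈ slimTriangle u :=
    ⟨vec 1 0, by simp [stdTriangle], by apply plane_ext <;> simp⟩
  have mB : vec u (u - 1) ∈ slimTriangle u :=
    ⟨vec 0 1, by simp [stdTriangle], by apply plane_ext <;> simp⟩
  have mC : vec 0 1 ∈ slimTriangle u :=
    ⟨vec 0 0, by simp [stdTriangle], by apply plane_ext <;> simp⟩
  have key : ∀ a b : ℤ, 0 < b → 1 ≤ halfWidth (slimTriangle u) (vec a b) := by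
    intro a b hb
    have hCA := inner_sub_le_halfWidth hc mC mA (vec a b)
    have hCB := inner_sub_le_halfWidth hc mC mB (vec a b)
    rw [inner_vec] at hCA hCB
    simp at hCA hCB
    have hb1 : (1 : ℝ) ≤ b := by exact_mod_cast hb
    by_cases ha : 0 ≤ a
    · have : (0 : ℝ) ≤ a := by exact_mod_cast ha
      nlinarith
    by_cases hab : a ≤ -b
    · have : (a : ℝ) ≤ -b := by exact_mod_cast hab
      nlinarith
    · have : (2 : ℝ) ≤ b := by exact_mod_cast (by omega : 2 ≤ b)
      nlinarith
  obtain ⟨a, b, rfl⟩ := hz.exists_vec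
  have hb : b ≠ 0 := by simpa using hz1
  rcases lt_or_gt_of_ne hb with hb | hb
  · have := key (-a) (-b) (by omega)
    rw [← halfWidth_neg hc hne, neg_vec]
    exact_mod_cast this
  · exact key a b hb

lemma slimTriangle_mem_Aclass {t : ℝ} (ht : 1 ≤ t) : slimTriangle (1 / t) ∈ Aclass t := by
  have ht0 : 0 < t := by linarith
  have hu : 0 < 1 / t := by positivity
  have hu1 : 1 / t ≤ 1 := by rw [div_le_one ht0]; exact ht
  set u := 1 / t with hut
  have hc : IsCompact (slimTriangle u) := isCompact_triangle _ _ _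
  have h0 := zero_mem_interior_slimTriangle hu hu1
  have hne : (slimTriangle u).Nonempty := ⟨0, interior_subset h0⟩
  have mA : vec (-u) (-1) ∈ slimTriangle u :=
    ⟨vec 1 0, by simp [stdTriangle], by apply plane_ext <;> simp⟩
  have mB : vec u (u - 1) ∈ slimTriangle u :=
    ⟨vec 0 1, by simp [stdTriangle], by apply plane_ext <;> simp⟩
  refine mem_Aclass_of_halfWidth ht ⟨convex_triangle _ _ _, hc, ⟨0, h0⟩⟩ h0 ?_ ?_
    fun z hz hz1 => one_le_halfWidth_slimTriangle hu hu1 hz hz1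
  · rw [← hut]
    refine le_antisymm ?_ ?_
    · obtain ⟨x, hx, y, hy, h⟩ := exists_inner_sub_eq_halfWidth hc hne e1
      obtain ⟨r, s, hr, hs, hrs, hx0, -⟩ := slimTriangle_coords hx
      obtain ⟨r', s', hr', hs', hrs', hy0, -⟩ := slimTriangle_coords hy
      rw [e1_eq, inner_vec] at h
      rw [e1_eq]
      simp only [PiLp.sub_apply, hx0, hy0] at h
      nlinarith
    · have := inner_sub_le_halfWidth hc mB mA e1
      rw [e1_eq, inner_vec] at this
      rw [e1_eq]
      simp at this
      linarith
  · refine le_antisymm ?_ (one_le_halfWidth_slimTriangle hu hu1 ?_ ?_)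
    · obtain ⟨x, hx, y, hy, h⟩ := exists_inner_sub_eq_halfWidth hc hne e2
      obtain ⟨r, s, hr, hs, hrs, -, hx1⟩ := slimTriangle_coords hx
      obtain ⟨r', s', hr', hs', hrs', -, hy1⟩ := slimTriangle_coords hy
      rw [e2_eq, inner_vec] at h
      rw [e2_eq]
      simp only [PiLp.sub_apply, hx1, hy1] at h
      nlinarith
    · simpa [e2_eq] using isLatticePoint_vec 0 1
    · simp [e2_eq]

lemma volume_slimTriangle {u : ℝ} (hu : 0 < u) (hu1 : u ≤ 1) : volume (slimTriangle u) =
    ENNReal.ofReal (u * (4 - u)) * volume stdTriangle := by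
  rw [slimTriangle, volume_triangle, ← abs_of_pos (mul_pos hu (by linarith : 0 < 4 - u))]
  congr 3
  simp
  ring

/-- An area minimizer has no lattice basis `(p, q)` for which `q - p`, `q`, `q + p` all have half
width `1`. -/
lemma not_three_collinear_of_mem_Mclass {t : ℝ} (ht : 1 ≤ t) {K : Set (E 2)} (hK : K ∈ Mclass t)
    {p q : E 2} (hdet : |p 0 * q 1 - p 1 * q 0| = 1) (hp : 1 / t ≤ halfWidth K p)
    (h0 : halfWidth K q = 1) (h1 : halfWidth K (q + p) ≤ 1) (h2 : halfWidth K (q - p) ≤ 1) :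
    False := by
  have ht0 : 0 < t := by linarith
  have hu : 0 < 1 / t := by positivity
  have hu1 : 1 / t ≤ 1 := by rw [div_le_one ht0]; exact ht
  obtain ⟨⟨hb, hint, -⟩, hmin⟩ := hK
  have hlow := le_volume_of_halfWidth_eq_one hb.1 hb.2.1 ⟨0, interior_subset hint⟩ hdet h0 h1 h2
  have hup := hlow.trans (hmin _ (slimTriangle_mem_Aclass ht))
  rw [volume_slimTriangle hu hu1, ENNReal.mul_le_mul_iff_left volume_stdTriangle_pos.ne'
    isCompact_stdTriangle.measure_lt_top.ne, ENNReal.ofReal_le_ofReal_iff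
    (mul_nonneg hu.le (by linarith))] at hup
  nlinarith

/-- The lattice points of half width `1` off the first axis lie at height `±1`. -/
lemma height_le_one_of_mem_Mclass {t : ℝ} (ht : 1 ≤ t) {K : Set (E 2)} (hK : K ∈ Mclass t)
    {a b : ℤ} (hb : 0 < b) (h : halfWidth K (vec a b) = 1) : b = 1 := by
  have ht0 : 0 < t := by linarith
  have hu1 : 1 / t ≤ 1 := by rw [div_le_one ht0]; exact ht
  have hc : IsCompact K := hK.1.1.2.1
  have hne : K.Nonempty := ⟨0, interior_subset hK.1.2.1⟩
  obtain ⟨w1, -, hw⟩ := halfWidth_of_mem_Aclass ht hK.1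
  have hstep : ∀ k : ℤ, (b : ℝ) * halfWidth K (vec k 1) ≤ 1 + |(b * k - a : ℤ)| * (1 / t) := by
    intro k
    have hadd := halfWidth_add_le hc hne (vec a b) (((b * k - a : ℤ) : ℝ) • e1)
    have he : vec a b + ((b * k - a : ℤ) : ℝ) • e1 = (b : ℝ) • vec k 1 := by
      rw [e1_eq, smul_vec, smul_vec, vec_add]
      push_cast
      congr 1 <;> ring
    rw [he, halfWidth_smul hc hne, halfWidth_smul hc hne, w1, h,
      abs_of_pos (by exact_mod_cast hb)] at hadd
    exact_mod_cast hadd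
  have hge : ∀ k : ℤ, 1 ≤ halfWidth K (vec k 1) := fun k =>
    hw _ (by simpa using isLatticePoint_vec k 1) (by simp)
  have hb0 : (0 : ℝ) < b := by exact_mod_cast hb
  have hb2 : ∀ k : ℤ, 2 * |b * k - a| ≤ b → b ≤ 2 := by
    intro k hk
    have h1 := hstep k
    have h2 := hge k
    have hk' : 2 * ((|b * k - a| : ℤ) : ℝ) ≤ b := by exact_mod_cast hk
    have h3 : ((|b * k - a| : ℤ) : ℝ) * (1 / t) ≤ (|b * k - a| : ℤ) :=
      mul_le_of_le_one_right (by exact_mod_cast abs_nonneg _) hu1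
    have : (b : ℝ) ≤ 2 := by nlinarith
    exact_mod_cast this
  have hble : b ≤ 2 := by
    have hdm := Int.emod_add_mul_ediv a b
    have hm0 := Int.emod_nonneg a hb.ne'
    have hm1 := Int.emod_lt_of_pos a hb
    by_cases hm : 2 * (a % b) ≤ b
    · refine hb2 (a / b) ?_
      rw [show b * (a / b) - a = -(a % b) by linarith, abs_neg, abs_of_nonneg hm0]
      exact hm
    · refine hb2 (a / b + 1) ?_
      rw [show b * (a / b + 1) - a = b - a % b by linarith, abs_of_pos (by linarith)]
      linarith
  by_contra hb1
  obtain rfl : b = 2 := by omega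
  rcases Int.even_or_odd' a with ⟨m, rfl | rfl⟩
  · have h1 := hstep m
    have h2 := hge m
    simp only [sub_self, abs_zero] at h1
    push_cast at h1
    linarith
  · have h1 := hstep m
    have h2 := hstep (m + 1)
    rw [show 2 * m - (2 * m + 1) = -1 by ring] at h1
    rw [show 2 * (m + 1) - (2 * m + 1) = 1 by ring] at h2
    have h3 := hge m
    have h4 := hge (m + 1)
    norm_num at h1 h2 h4
    rw [one_div] at hu1 w1
    refine not_three_collinear_of_mem_Mclass ht hK (p := vec m 1) (q := vec (m + 1) 1) ?_ ?_ ?_ ?_ ?_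
    · simp
    · rw [one_div]
      linarith
    · linarith
    · have : vec (m + 1) 1 + vec m 1 = vec (2 * m + 1 : ℤ) (2 : ℤ) := by
        rw [vec_add, vec_inj]
        push_cast
        constructor <;> ring
      rw [this, h]
    · have : vec (m + 1) 1 - vec m 1 = e1 := by
        rw [e1_eq]
        apply plane_ext <;> simp
      rw [this, w1]
      exact hu1

/-- The lattice points of half width `1` off the first axis. -/
def unitPoints (K : Set (E 2)) : Set (E 2) :=
  {z | isLatticePoint z ∧ z 1 ≠ 0 ∧ halfWidth K z = 1}

lemma unitPoints_eq {t : ℝ} (ht : 1 ≤ t) {K : Set (E 2)} (hK : K ∈ Mclass t) :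
    unitPoints K = {vec 0 1, -vec 0 1} ∨
      ∃ k : ℤ, k ≠ 0 ∧ unitPoints K = {vec 0 1, -vec 0 1, vec k 1, -vec k 1} := by
  have hc : IsCompact K := hK.1.1.2.1
  have hne : K.Nonempty := ⟨0, interior_subset hK.1.2.1⟩
  obtain ⟨w1, w2, hw⟩ := halfWidth_of_mem_Aclass ht hK.1
  rw [e2_eq] at w2
  have hcol : ∀ m n : ℤ, m + 2 ≤ n → halfWidth K (vec m 1) = 1 → halfWidth K (vec n 1) = 1 →
      False := by
    intro m n hmn hm hn
    have hmid : ∀ k : ℤ, m ≤ k → k ≤ n → halfWidth K (vec k 1) ≤ 1 := by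
      intro k hmk hkn
      have hadd := halfWidth_add_le hc hne (((n - k : ℤ) : ℝ) • vec m 1) (((k - m : ℤ) : ℝ) • vec n 1)
      have he : ((n - k : ℤ) : ℝ) • vec m 1 + ((k - m : ℤ) : ℝ) • vec n 1 =
          ((n - m : ℤ) : ℝ) • vec k 1 := by
        rw [smul_vec, smul_vec, smul_vec, vec_add]
        push_cast
        congr 1 <;> ring
      have p0 : (0 : ℝ) ≤ (n - k : ℤ) := by exact_mod_cast (by omega : 0 ≤ n - k)
      have p1 : (0 : ℝ) ≤ (k - m : ℤ) := by exact_mod_cast (by omega : 0 ≤ k - m)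
      have p2 : (0 : ℝ) < (n - m : ℤ) := by exact_mod_cast (by omega : 0 < n - m)
      rw [he, halfWidth_smul hc hne, halfWidth_smul hc hne, halfWidth_smul hc hne, hm, hn,
        abs_of_nonneg p0, abs_of_nonneg p1, abs_of_pos p2] at hadd
      push_cast at hadd p2
      nlinarith
    have hq := hmid (m + 1) (by omega) (by omega)
    have hq' := hw (vec (m + 1 : ℤ) 1) (by simpa using isLatticePoint_vec (m + 1) 1) (by simp)
    refine not_three_collinear_of_mem_Mclass ht hK (p := e1) (q := vec (m + 1 : ℤ) 1) ?_ w1.ge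
      (hq.antisymm hq') ?_ ?_
    · simp [e1_eq]
    · have : vec (m + 1 : ℤ) 1 + e1 = vec (m + 2 : ℤ) 1 := by
        rw [e1_eq, vec_add, vec_inj]
        push_cast
        constructor <;> ring
      rw [this]
      exact hmid (m + 2) (by omega) hmn
    · have : vec (m + 1 : ℤ) 1 - e1 = vec m 1 := by
        rw [e1_eq]
        apply plane_ext <;> simp
      rw [this, hm]
  have hneg : ∀ z ∈ unitPoints K, -z ∈ unitPoints K := by
    rintro z ⟨hl, h1, h⟩
    obtain ⟨a, b, rfl⟩ := hl.exists_vec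
    refine ⟨?_, ?_, by rw [halfWidth_neg hc hne, h]⟩
    · rw [neg_vec]
      exact_mod_cast isLatticePoint_vec (-a) (-b)
    · simpa using h1
  have hmem : ∀ k : ℤ, halfWidth K (vec k 1) = 1 → vec k 1 ∈ unitPoints K := fun k hk =>
    ⟨by simpa using isLatticePoint_vec k 1, by simp, hk⟩
  have hform : ∀ z ∈ unitPoints K, ∃ k : ℤ, halfWidth K (vec k 1) = 1 ∧
      (z = vec k 1 ∨ z = -vec k 1) := by
    rintro z ⟨hl, h1, h⟩
    obtain ⟨a, b, rfl⟩ := hl.exists_vec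
    have hb : b ≠ 0 := by simpa using h1
    rcases lt_or_gt_of_ne hb with hb | hb
    · have h' : halfWidth K (vec (-a : ℤ) (-b : ℤ)) = 1 := by
        rw [← h, ← halfWidth_neg hc hne (vec a b), neg_vec]
        push_cast
        rfl
      have hb1 := height_le_one_of_mem_Mclass ht hK (by omega) h'
      refine ⟨-a, by simpa [hb1] using h', Or.inr ?_⟩
      obtain rfl : b = -1 := by omega
      apply plane_ext <;> simp
    · obtain rfl := height_le_one_of_mem_Mclass ht hK hb h
      exact ⟨a, by simpa using h, Or.inl (by simp)⟩
  have hw0 : halfWidth K (vec (0 : ℤ) 1) = 1 := by simpa using w2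
  have m0 : vec 0 1 ∈ unitPoints K := by simpa using hmem 0 hw0
  by_cases hex : ∃ k : ℤ, k ≠ 0 ∧ halfWidth K (vec k 1) = 1
  · obtain ⟨k, hk, hwk⟩ := hex
    refine Or.inr ⟨k, hk, Set.Subset.antisymm ?_ ?_⟩
    · intro z hz
      obtain ⟨j, hj, hzj⟩ := hform z hz
      have hjk : j = 0 ∨ j = k := by
        by_contra! hjk
        have c0 : ¬ 2 ≤ j := fun h => hcol 0 j (by omega) hw0 hj
        have c1 : ¬ j ≤ -2 := fun h => hcol j 0 (by omega) hj hw0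
        have c2 : ¬ 2 ≤ k := fun h => hcol 0 k (by omega) hw0 hwk
        have c3 : ¬ k ≤ -2 := fun h => hcol k 0 (by omega) hwk hw0
        have c4 : ¬ j + 2 ≤ k := fun h => hcol j k h hj hwk
        have c5 : ¬ k + 2 ≤ j := fun h => hcol k j h hwk hj
        omega
      rcases hjk with rfl | rfl <;> rcases hzj with rfl | rfl <;> simp
    · rintro z (rfl | rfl | rfl | rfl)
      exacts [m0, hneg _ m0, hmem k hwk, hneg _ (hmem k hwk)]
  · refine Or.inl (Set.Subset.antisymm ?_ ?_)
    · intro z hz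
      obtain ⟨j, hj, hzj⟩ := hform z hz
      obtain rfl : j = 0 := by
        by_contra hj0
        exact hex ⟨j, hj0, hj⟩
      rcases hzj with rfl | rfl <;> simp
    · rintro z (rfl | rfl)
      exacts [m0, hneg _ m0]

lemma gauge_polarBody_pos {n : ℕ} {K : Set (E n)} (hK : IsCompact K) (h0 : (0 : E n) ∈ interior K)
    {z : E n} (hz : z ≠ 0) : 0 < gauge (polarBody K) z := by
  obtain ⟨ε, hε, hball⟩ := Metric.mem_nhds_iff.1 (mem_interior_iff_mem_nhds.1 h0)
  have hzn : 0 < ‖z‖ := norm_pos_iff.2 hz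
  have hmem : (ε / 2 / ‖z‖) • z ∈ K := by
    refine hball ?_
    rw [mem_ball_zero_iff, norm_smul, Real.norm_of_nonneg (by positivity), div_mul_cancel₀ _ hzn.ne']
    linarith
  have h := (isGreatest_gauge_polarBody hK (interior_subset h0) z).2 ⟨_, hmem, rfl⟩
  refine lt_of_lt_of_le ?_ h
  simp only [real_inner_smul_left, real_inner_self_eq_norm_sq]
  positivity

/-- Radial rescaling identifies `Cset K` with the unit points together with `±e1`. -/
lemma ncard_Cset {t : ℝ} {K : Set (E 2)} (hK : K ∈ Aclass t) :
    (Cset K).ncard = (unitPoints K ∪ {e1, -e1}).ncard := by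
  have hc : IsCompact K := hK.1.2.1
  have hne : K.Nonempty := ⟨0, interior_subset hK.2.1⟩
  have hpos : ∀ z ∈ unitPoints K ∪ {e1, -e1}, 0 < gauge (polarBody K) z := by
    intro z hz
    refine gauge_polarBody_pos hc hK.2.1 ?_
    rintro rfl
    rcases hz with ⟨-, h, -⟩ | h | h
    · exact h rfl
    · simpa [e1_eq] using congrArg (fun z : E 2 => z 0) h
    · simpa [e1_eq] using congrArg (fun z : E 2 => z 0) h
  have hscale : ∀ c : ℝ, 0 < c → ∀ z : E 2,
      (gauge (polarBody K) (c • z))⁻¹ • c • z = (gauge (polarBody K) z)⁻¹ • z := by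
    intro c hc z
    rw [gauge_smul_of_nonneg hc.le, smul_eq_mul, smul_smul, mul_inv]
    congr 1
    field_simp
  have himg : Cset K =
      (fun z => (gauge (polarBody K) z)⁻¹ • z) '' (unitPoints K ∪ {e1, -e1}) := by
    refine Set.Subset.antisymm ?_ ?_
    · rintro _ ⟨z, ⟨hl, hz⟩ | hz, rfl⟩
      · by_cases h1 : z 1 = 0
        · have hz0 : z 0 ≠ 0 := by
            intro h0
            obtain rfl : z = 0 := plane_ext h0 h1
            simp at hz
          rcases lt_or_gt_of_ne hz0 with h | h
          · refine ⟨-e1, Or.inr (by simp), ?_⟩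
            have he : z = (-z 0) • -e1 := by
              rw [e1_eq]
              apply plane_ext <;> simp [h1]
            conv_rhs => rw [he]
            exact (hscale _ (by linarith) _).symm
          · refine ⟨e1, Or.inr (by simp), ?_⟩
            have he : z = (z 0) • e1 := by
              rw [e1_eq]
              apply plane_ext <;> simp [h1]
            conv_rhs => rw [he]
            exact (hscale _ h _).symm
        · exact ⟨z, Or.inl ⟨hl, h1, hz⟩, rfl⟩
      · exact ⟨z, Or.inr hz, rfl⟩
    · rintro _ ⟨z, ⟨hl, -, hz⟩ | hz, rfl⟩
      · exact ⟨z, Or.inl ⟨hl, hz⟩, rfl⟩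
      · exact ⟨z, Or.inr hz, rfl⟩
  rw [himg]
  refine Set.InjOn.ncard_image ?_
  intro x hx y hy hxy
  have px := hpos x hx
  have py := hpos y hy
  obtain ⟨c, hc0, rfl⟩ : ∃ c : ℝ, 0 < c ∧ x = c • y := by
    refine ⟨gauge (polarBody K) x * (gauge (polarBody K) y)⁻¹, by positivity, ?_⟩
    rw [mul_smul, ← show (gauge (polarBody K) x)⁻¹ • x = (gauge (polarBody K) y)⁻¹ • y from hxy,
      smul_inv_smul₀ px.ne']
  have hunit : ∀ z ∈ ({e1, -e1} : Set (E 2)), z 1 = 0 ∧ |z 0| = 1 := by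
    rintro z (rfl | rfl) <;> simp [e1_eq]
  suffices hc1 : c = 1 by rw [hc1, one_smul]
  rcases hx with ⟨-, x1, hx⟩ | hx <;> rcases hy with ⟨-, y1, hy⟩ | hy
  · rw [halfWidth_smul hc hne, hy, mul_one, abs_of_pos hc0] at hx
    exact hx
  · simp [(hunit y hy).1] at x1
  · have := (hunit _ hx).1
    simp [hc0.ne', y1] at this
  · have := (hunit _ hx).2
    simpa [abs_mul, (hunit y hy).2, abs_of_pos hc0] using this

theorem Cset_card_le_six (t : ℝ) (ht : 1 ≤ t) (K : Set (E 2))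
    (hK : K ∈ Mclass t) :
    (Cset K).ncard ≤ 6 ∧ ((Cset K).ncard = 4 ∨ (Cset K).ncard = 6) := by
  have hcard : (Cset K).ncard = 4 ∨ (Cset K).ncard = 6 := by
    rw [ncard_Cset hK.1, e1_eq]
    rcases unitPoints_eq ht hK with h | ⟨k, hk, h⟩
    · left
      rw [h, show ({vec 0 1, -vec 0 1} ∪ {vec 1 0, -vec 1 0} : Set (E 2)) =
        ({vec 0 1, -vec 0 1, vec 1 0, -vec 1 0} : Finset (E 2)) by ext; simp; tauto,
        Set.ncard_coe_finset]
      repeat rw [Finset.card_insert_of_notMem (by simp [neg_vec, vec_inj] <;> norm_num)]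
      simp
    · right
      have hk' : (k : ℝ) ≠ 0 := by exact_mod_cast hk
      rw [h, show ({vec 0 1, -vec 0 1, vec k 1, -vec k 1} ∪ {vec 1 0, -vec 1 0} : Set (E 2)) =
        ({vec 0 1, -vec 0 1, vec k 1, -vec k 1, vec 1 0, -vec 1 0} : Finset (E 2)) by
          ext; simp; tauto,
        Set.ncard_coe_finset]
      repeat rw [Finset.card_insert_of_notMem (by simp [neg_vec, vec_inj, hk, hk'.symm] <;> norm_num)]
      simp
  exact ⟨by omega, hcard⟩
end
end

section
/- Fix t ≥ 1. Then M(t) contains no quadrilateral, i.e., no convex body of minimal area in A(t) is a polygon with exactly 4 vertices. -/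
open MeasureTheory
open scoped RealInnerProductSpace Pointwise

noncomputable section

/-- The planar cross product. -/
def cross (a b : E 2) : ℝ := a 0 * b 1 - a 1 * b 0

/-- The linear map sending the standard basis to `u, v`. -/
def frameMap (u v : E 2) : E 2 →ₗ[ℝ] E 2 where
  toFun p := p 0 • u + p 1 • v
  map_add' p q := by simp only [PiLp.add_apply]; module
  map_smul' c p := by simp only [PiLp.smul_apply, smul_eq_mul, RingHom.id_apply]; module

lemma frameMap_apply (u v p : E 2) : frameMap u v p = p 0 • u + p 1 • v := rfl

lemma det_frameMap (u v : E 2) : LinearMap.det (frameMap u v) = cross u v := by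
  rw [← LinearMap.det_toMatrix (EuclideanSpace.basisFun (Fin 2) ℝ).toBasis, Matrix.det_fin_two]
  simp [LinearMap.toMatrix_apply, frameMap_apply, cross]
  ring

/-- The open standard triangle. -/
def openTriangle : Set (E 2) := {p | 0 < p 0 ∧ 0 < p 1 ∧ p 0 + p 1 < 1}

/-- The closed standard triangle. -/
def closedTriangle : Set (E 2) := {p | 0 ≤ p 0 ∧ 0 ≤ p 1 ∧ p 0 + p 1 ≤ 1}

lemma continuous_coord (i : Fin 2) : Continuous fun p : E 2 => p i := by fun_prop

lemma isOpen_openTriangle : IsOpen openTriangle :=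
  (isOpen_lt continuous_const (continuous_coord 0)).inter
    ((isOpen_lt continuous_const (continuous_coord 1)).inter
      (isOpen_lt ((continuous_coord 0).add (continuous_coord 1)) continuous_const))

lemma isCompact_closedTriangle : IsCompact closedTriangle := by
  refine Metric.isCompact_of_isClosed_isBounded ?_ ?_
  · exact (isClosed_le continuous_const (continuous_coord 0)).inter
      ((isClosed_le continuous_const (continuous_coord 1)).inter
        (isClosed_le ((continuous_coord 0).add (continuous_coord 1)) continuous_const))
  · refine isBounded_iff_forall_norm_le.2 ⟨2, fun p hp => ?_⟩
    obtain ⟨h0, h1, h2⟩ := hp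
    rw [EuclideanSpace.norm_eq, Fin.sum_univ_two]
    refine Real.sqrt_le_iff.2 ⟨by norm_num, ?_⟩
    simp only [Real.norm_eq_abs, sq_abs]
    nlinarith

lemma convex_closedTriangle : Convex ℝ closedTriangle := by
  intro p hp q hq a b ha hb hab
  obtain ⟨h0, h1, h2⟩ := hp
  obtain ⟨k0, k1, k2⟩ := hq
  simp only [closedTriangle, Set.mem_ofPred_eq, PiLp.add_apply, PiLp.smul_apply, smul_eq_mul]
  refine ⟨by positivity, by positivity, ?_⟩
  nlinarith

lemma volume_openTriangle : volume openTriangle = ENNReal.ofReal (1 / 2) := by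
  have hmp := (EuclideanSpace.volume_preserving_symm_measurableEquiv_toLp (Fin 2))
  have hmp2 := MeasureTheory.volume_preserving_finTwoArrow ℝ
  have h := hmp2.comp hmp
  have hset : openTriangle =
      (fun p : E 2 => ((p 0, p 1) : ℝ × ℝ)) ⁻¹'
        regionBetween (fun _ => 0) (fun x => 1 - x) (Set.Ioo (0 : ℝ) 1) := by
    ext p
    simp only [openTriangle, regionBetween, Set.mem_ofPred_eq, Set.mem_preimage, Set.mem_Ioo]
    constructor
    · rintro ⟨h0, h1, h2⟩
      exact ⟨⟨h0, by linarith⟩, h1, by linarith⟩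
    · rintro ⟨⟨h0, -⟩, h1, h2⟩
      exact ⟨h0, h1, by linarith⟩
  have hmeas : MeasurableSet
      (regionBetween (fun _ => (0 : ℝ)) (fun x => 1 - x) (Set.Ioo (0 : ℝ) 1)) :=
    measurableSet_regionBetween measurable_const (by fun_prop) measurableSet_Ioo
  rw [hset]
  have := h.measure_preimage hmeas.nullMeasurableSet
  refine Eq.trans ?_ (this.trans ?_)
  · rfl
  · rw [Measure.volume_eq_prod, volume_regionBetween_eq_integral]
    · congr 1
      rw [← integral_Ioc_eq_integral_Ioo, ← intervalIntegral.integral_of_le zero_le_one]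
      simp only [Pi.sub_apply, sub_zero]
      rw [intervalIntegral.integral_sub (continuous_const.intervalIntegrable _ _)
        (continuous_id'.intervalIntegrable _ _)]
      norm_num [integral_id]
    · exact integrableOn_const (by simp)
    · exact ((continuous_const.sub continuous_id).integrableOn_Icc).mono_set Set.Ioo_subset_Icc_self
    · exact measurableSet_Ioo
    · intro x hx
      simpa using hx.2.le

lemma interior_closedTriangle_subset : interior closedTriangle ⊆ openTriangle := by
  have key (f : E 2 →ₗ[ℝ] ℝ) (hf : Function.Surjective f) (h : ∀ p ∈ closedTriangle, 0 ≤ f p)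
      (p : E 2) (hp : p ∈ interior closedTriangle) : 0 < f p := by
    have ho : IsOpen (f '' interior closedTriangle) :=
      f.isOpenMap_of_finiteDimensional hf _ isOpen_interior
    have hs : f '' interior closedTriangle ⊆ Set.Ici 0 := by
      rintro _ ⟨q, hq, rfl⟩
      exact h q (interior_subset hq)
    have := interior_maximal hs ho
    rw [interior_Ici] at this
    exact this ⟨p, hp, rfl⟩
  intro p hp
  let c (i : Fin 2) : E 2 →ₗ[ℝ] ℝ := (EuclideanSpace.proj i : E 2 →L[ℝ] ℝ).toLinearMap
  have hc (i : Fin 2) (q : E 2) : c i q = q i := rfl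
  have h0 := key (c 0) (fun x => ⟨!₂[x, 0], by simp [hc]⟩) (fun q hq => hq.1) p hp
  have h1 := key (c 1) (fun x => ⟨!₂[0, x], by simp [hc]⟩) (fun q hq => hq.2.1) p hp
  have hcl (q : E 2) (hq : q ∈ closedTriangle) : q 0 + q 1 ≤ 1 := hq.2.2
  have ho : IsOpen ((c 0 + c 1) '' interior closedTriangle) :=
    (c 0 + c 1).isOpenMap_of_finiteDimensional (fun x => ⟨!₂[x, 0], by simp [hc]⟩) _
      isOpen_interior
  have hs : (c 0 + c 1) '' interior closedTriangle ⊆ Set.Iic 1 := by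
    rintro _ ⟨q, hq, rfl⟩
    exact hcl q (interior_subset hq)
  have h2 := interior_maximal hs ho
  rw [interior_Iic] at h2
  exact ⟨h0, h1, h2 ⟨p, hp, rfl⟩⟩

lemma volume_closedTriangle_le : volume closedTriangle ≤ ENNReal.ofReal (1 / 2) := by
  have hf := convex_closedTriangle.addHaar_frontier (volume : Measure (E 2))
  have hsub : closedTriangle ⊆ openTriangle ∪ frontier closedTriangle := by
    intro p hp
    by_cases h : p ∈ interior closedTriangle
    · exact Or.inl (interior_closedTriangle_subset h)
    · exact Or.inr ⟨subset_closure hp, h⟩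
  calc volume closedTriangle ≤ volume openTriangle + volume (frontier closedTriangle) :=
        (measure_mono hsub).trans (measure_union_le _ _)
    _ = ENNReal.ofReal (1 / 2) := by rw [hf, volume_openTriangle, add_zero]

lemma volume_translate_frameMap_image (c u v : E 2) (S : Set (E 2)) :
    volume ((fun p => c + frameMap u v p) '' S) = ENNReal.ofReal |cross u v| * volume S := by
  have : (fun p => c + frameMap u v p) '' S = (fun q => c + q) '' (frameMap u v '' S) := by
    rw [Set.image_image]
  rw [this, Set.image_add_left, measure_preimage_add, Measure.addHaar_image_linearMap,
    det_frameMap]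

lemma volume_openTriangle_image (c u v : E 2) :
    volume ((fun p => c + frameMap u v p) '' openTriangle) = ENNReal.ofReal (|cross u v| / 2) := by
  rw [volume_translate_frameMap_image, volume_openTriangle, ← ENNReal.ofReal_mul (abs_nonneg _)]
  congr 1
  ring

lemma image_openTriangle_subset {K : Set (E 2)} (hK : Convex ℝ K) {a b c : E 2} (ha : a ∈ K)
    (hb : b ∈ K) (hc : c ∈ K) :
    (fun p => a + frameMap (b - a) (c - a) p) '' openTriangle ⊆ K := by
  rintro _ ⟨p, ⟨h0, h1, h2⟩, rfl⟩
  have := hK.sum_mem (t := Finset.univ) (w := ![1 - p 0 - p 1, p 0, p 1])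
    (z := ![a, b, c])
    (by intro i _; fin_cases i <;> simp <;> linarith)
    (by simp [Fin.sum_univ_three]; ring)
    (by intro i _; fin_cases i <;> simpa)
  convert this using 1
  simp only [frameMap_apply, Fin.sum_univ_three, Matrix.cons_val_zero, Matrix.cons_val_one,
    Matrix.cons_val]
  module

lemma cross_triangle_le {K : Set (E 2)} (hK : Convex ℝ K) {a b c : E 2} (ha : a ∈ K)
    (hb : b ∈ K) (hc : c ∈ K) :
    ENNReal.ofReal (|cross (b - a) (c - a)| / 2) ≤ volume K := by
  rw [← volume_openTriangle_image a]
  exact measure_mono (image_openTriangle_subset hK ha hb hc)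

lemma cross_frameMap (u v p : E 2) : cross u (frameMap u v p) = p 1 * cross u v := by
  simp [cross, frameMap_apply]
  ring

lemma surjective_frameMap {u v : E 2} (h : cross u v ≠ 0) :
    Function.Surjective (frameMap u v) := by
  have hu : IsUnit (LinearMap.det (frameMap u v)) := by
    rw [det_frameMap]; exact h.isUnit
  exact ((LinearMap.isUnit_iff_isUnit_det _).2 hu |> (Module.End.isUnit_iff _).1).surjective

lemma measurableSet_openTriangle_image (a u v : E 2) (h : cross u v ≠ 0) :
    MeasurableSet ((fun p => a + frameMap u v p) '' openTriangle) := by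
  have ho := (frameMap u v).isOpenMap_of_finiteDimensional (surjective_frameMap h)
  exact (((isOpenMap_add_left a).comp ho) _ isOpen_openTriangle).measurableSet

/-- Twice the area of a convex set dominates the cross product of any two of its chords. -/
lemma cross_chords_le {K : Set (E 2)} (hK : Convex ℝ K) {a b c d : E 2} (ha : a ∈ K)
    (hb : b ∈ K) (hc : c ∈ K) (hd : d ∈ K) :
    ENNReal.ofReal (|cross (b - a) (d - c)| / 2) ≤ volume K := by
  have hsub : cross (b - a) (d - c) = cross (b - a) (d - a) - cross (b - a) (c - a) := by
    simp [cross]; ring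
  set x := cross (b - a) (d - a) with hx
  set y := cross (b - a) (c - a) with hy
  have hX := cross_triangle_le hK ha hb hd
  have hY := cross_triangle_le hK ha hb hc
  rw [← hx] at hX
  rw [← hy] at hY
  rw [hsub]
  rcases le_or_gt 0 (x * y) with h | h
  · have : |x - y| ≤ max |x| |y| := by
      rcases mul_nonneg_iff.1 h with ⟨h1, h2⟩ | ⟨h1, h2⟩
      · rw [abs_of_nonneg h1, abs_of_nonneg h2]
        rw [abs_le]
        constructor <;> linarith [le_max_left x y, le_max_right x y]
      · rw [abs_of_nonpos h1, abs_of_nonpos h2, abs_le]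
        constructor <;> linarith [le_max_left (-x) (-y), le_max_right (-x) (-y)]
    rcases le_max_iff.1 this with h' | h'
    · exact (ENNReal.ofReal_le_ofReal (by linarith)).trans hX
    · exact (ENNReal.ofReal_le_ofReal (by linarith)).trans hY
  · have habs : |x - y| = |x| + |y| := by
      rcases mul_neg_iff.1 h with ⟨h1, h2⟩ | ⟨h1, h2⟩
      · rw [abs_of_pos h1, abs_of_neg h2, abs_of_pos (by linarith)]; ring
      · rw [abs_of_neg h1, abs_of_pos h2, abs_of_neg (by linarith)]; ring
    have hy0 : y ≠ 0 := by rintro h0; simp [h0] at h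
    have hdisj : Disjoint ((fun p => a + frameMap (b - a) (d - a) p) '' openTriangle)
        ((fun p => a + frameMap (b - a) (c - a) p) '' openTriangle) := by
      rw [Set.disjoint_left]
      rintro _ ⟨p, hp, rfl⟩ ⟨q, hq, hpq⟩
      have hpq' := add_left_cancel hpq
      have e := congrArg (cross (b - a)) hpq'
      rw [cross_frameMap, cross_frameMap, ← hx, ← hy] at e
      have hp1 : 0 < p 1 := hp.2.1
      have hq1 : 0 < q 1 := hq.2.1
      rcases mul_neg_iff.1 h with ⟨h1, h2⟩ | ⟨h1, h2⟩
      · linarith [mul_pos hp1 h1, mul_neg_of_pos_of_neg hq1 h2]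
      · linarith [mul_pos hq1 h2, mul_neg_of_pos_of_neg hp1 h1]
    rw [habs, add_div, ENNReal.ofReal_add (by positivity) (by positivity), hx, hy,
      ← volume_openTriangle_image a, ← volume_openTriangle_image a,
      ← measure_union hdisj (measurableSet_openTriangle_image _ _ _ hy0)]
    exact measure_mono (Set.union_subset (image_openTriangle_subset hK ha hb hd)
      (image_openTriangle_subset hK ha hb hc))

lemma mem_smul_polarBody_csBody {K : Set (E 2)} {lam : ℝ} (h : 0 < lam) (z : E 2) :
    z ∈ lam • polarBody (csBody K) ↔ ∀ a ∈ K, ∀ b ∈ K, ⟪a - b, z⟫ ≤ 2 * lam := by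
  rw [Set.mem_smul_set_iff_inv_smul_mem₀ h.ne']
  have key (a b : E 2) : ⟪(2⁻¹ : ℝ) • (a - b), lam⁻¹ • z⟫ ≤ 1 ↔ ⟪a - b, z⟫ ≤ 2 * lam := by
    rw [real_inner_smul_left, real_inner_smul_right, ← mul_assoc, ← mul_inv,
      inv_mul_le_iff₀ (by positivity), mul_one]
  constructor
  · intro hz a ha b hb
    exact (key a b).1 (hz _ (Set.smul_mem_smul_set (Set.sub_mem_sub ha hb)))
  · rintro hz _ ⟨_, ⟨a, ha, b, hb, rfl⟩, rfl⟩
    exact (key a b).2 (hz a ha b hb)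

lemma succMin_le {L : Set (E 2)} {i : ℕ} {lam : ℝ} (h : 0 < lam) (v : Fin i → E 2)
    (hv : LinearIndependent ℝ v) (hL : ∀ j, isLatticePoint (v j) ∧ v j ∈ lam • L) :
    succMin L i ≤ lam :=
  csInf_le ⟨0, fun _ hx => hx.1.le⟩ ⟨h, v, hv, hL⟩

lemma isLatticePoint_pair (m n : ℤ) : isLatticePoint (!₂[(m : ℝ), (n : ℝ)] : E 2) := by
  intro j
  fin_cases j
  · exact ⟨m, rfl⟩
  · exact ⟨n, rfl⟩

lemma isLatticePoint_e1 : isLatticePoint e1 := by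
  intro j
  fin_cases j
  · exact ⟨1, by simp [e1]⟩
  · exact ⟨0, by simp [e1]⟩

lemma isLatticePoint_e2 : isLatticePoint e2 := by
  intro j
  fin_cases j
  · exact ⟨0, by simp [e2]⟩
  · exact ⟨1, by simp [e2]⟩

lemma linearIndependent_e1 {z : E 2} (hz : z 1 ≠ 0) : LinearIndependent ℝ ![e1, z] := by
  rw [LinearIndependent.pair_iff]
  intro a b h
  have h1 := congrArg (fun p : E 2 => p 1) h
  have h0 := congrArg (fun p : E 2 => p 0) h
  simp [e1] at h1 h0
  have hb : b = 0 := h1.resolve_right hz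
  exact ⟨by simpa [hb] using h0, hb⟩

lemma Aclass.width_e1_le {t : ℝ} (ht : 1 ≤ t) {K : Set (E 2)} (hK : K ∈ Aclass t) {a b : E 2}
    (ha : a ∈ K) (hb : b ∈ K) : a 0 - b 0 ≤ 2 * (1 / t) := by
  obtain ⟨-, -, h1, -, h3, -⟩ := hK
  rw [h1, mem_smul_polarBody_csBody (by positivity)] at h3
  simpa [e1, EuclideanSpace.inner_single_right] using h3 a ha b hb

lemma Aclass.width_e2_le {t : ℝ} {K : Set (E 2)} (hK : K ∈ Aclass t) {a b : E 2}
    (ha : a ∈ K) (hb : b ∈ K) : a 1 - b 1 ≤ 2 := by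
  obtain ⟨-, -, -, h2, -, h4⟩ := hK
  rw [h2, mem_smul_polarBody_csBody (by positivity)] at h4
  simpa [e2, EuclideanSpace.inner_single_right] using h4 a ha b hb

lemma Aclass.le_of_width_e1 {t : ℝ} {K : Set (E 2)} (hK : K ∈ Aclass t) {lam : ℝ}
    (hlam : 0 < lam) (h : ∀ a ∈ K, ∀ b ∈ K, a 0 - b 0 ≤ 2 * lam) : 1 / t ≤ lam := by
  obtain ⟨-, -, h1, -, -, -⟩ := hK
  rw [← h1]
  refine succMin_le hlam ![e1] ?_ ?_
  · refine (LinearIndependent.of_subsingleton (0 : Fin 1) ?_)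
    simp [e1]
  · intro j
    fin_cases j
    refine ⟨isLatticePoint_e1, ?_⟩
    rw [mem_smul_polarBody_csBody hlam]
    intro a ha b hb
    simpa [e1, EuclideanSpace.inner_single_right] using h a ha b hb

lemma Aclass.one_le_of_width {t : ℝ} (ht : 1 ≤ t) {K : Set (E 2)} (hK : K ∈ Aclass t) {lam : ℝ}
    (hlam : 0 < lam) {z : E 2} (hz : isLatticePoint z) (hz1 : z 1 ≠ 0)
    (h : ∀ a ∈ K, ∀ b ∈ K, ⟪a - b, z⟫ ≤ 2 * lam) : 1 ≤ lam := by
  have hw : ∀ a ∈ K, ∀ b ∈ K, a 0 - b 0 ≤ 2 * (1 / t) :=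
    fun a ha b hb => Aclass.width_e1_le ht hK ha hb
  obtain ⟨-, -, h1, h2, -, -⟩ := hK
  by_contra! hlt
  have hL : 1 / t ≤ lam := by
    by_contra! hlt'
    refine hlt'.not_ge ?_
    rw [← h1]
    refine succMin_le hlam ![z] ?_ ?_
    · refine (LinearIndependent.of_subsingleton (0 : Fin 1) ?_)
      rintro h0
      exact hz1 (by simpa using congrArg (fun p : E 2 => p 1) h0)
    · intro j
      fin_cases j
      exact ⟨hz, (mem_smul_polarBody_csBody hlam _).2 h⟩
  refine hlt.not_ge ?_
  rw [← h2]
  refine succMin_le hlam ![e1, z] (linearIndependent_e1 hz1) ?_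
  intro j
  fin_cases j
  · refine ⟨isLatticePoint_e1, (mem_smul_polarBody_csBody hlam _).2 fun a ha b hb => ?_⟩
    have := hw a ha b hb
    simp [e1, EuclideanSpace.inner_single_right] at this ⊢
    simp at hL
    linarith
  · exact ⟨hz, (mem_smul_polarBody_csBody hlam _).2 h⟩

/-- The width of a hull in a direction is attained by two of the generating points. -/
lemma exists_width_points (w : Fin 4 → E 2) (f : E 2 →ₗ[ℝ] ℝ) :
    ∃ i j, (∀ k, f (w k) ≤ f (w i)) ∧ (∀ k, f (w j) ≤ f (w k)) ∧
      ∀ a ∈ convexHull ℝ (Set.range w), ∀ b ∈ convexHull ℝ (Set.range w),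
        f (a - b) ≤ f (w i) - f (w j) := by
  obtain ⟨i, hi⟩ := Finite.exists_max fun k => f (w k)
  obtain ⟨j, hj⟩ := Finite.exists_min fun k => f (w k)
  refine ⟨i, j, hi, hj, fun a ha b hb => ?_⟩
  have h1 : convexHull ℝ (Set.range w) ⊆ {p | f p ≤ f (w i)} :=
    convexHull_min (by rintro _ ⟨k, rfl⟩; exact hi k) (convex_halfSpace_le f.isLinear _)
  have h2 : convexHull ℝ (Set.range w) ⊆ {p | f (w j) ≤ f p} :=
    convexHull_min (by rintro _ ⟨k, rfl⟩; exact hj k) (convex_halfSpace_ge f.isLinear _)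
  have h3 : f a ≤ f (w i) := h1 ha
  have h4 : f (w j) ≤ f b := h2 hb
  rw [map_sub]
  linarith

/-- The comparison triangle, with vertices `(0, 0), (2s, s), (s, 2)` up to translation. -/
def minTriangle (s : ℝ) : Set (E 2) :=
  (fun p => !₂[-s, -(s + 2) / 3] + frameMap !₂[2 * s, s] !₂[s, 2] p) '' closedTriangle

lemma cross_minTriangle (s : ℝ) : cross !₂[2 * s, s] !₂[s, 2] = 4 * s - s ^ 2 := by
  simp [cross]
  ring

lemma volume_minTriangle_le {s : ℝ} (hs : 0 < s) (hs1 : s ≤ 1) :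
    volume (minTriangle s) ≤ ENNReal.ofReal ((4 * s - s ^ 2) / 2) := by
  have hD : 0 ≤ 4 * s - s ^ 2 := by nlinarith
  rw [minTriangle, volume_translate_frameMap_image, cross_minTriangle, abs_of_nonneg hD,
    div_eq_mul_one_div (4 * s - s ^ 2), ENNReal.ofReal_mul hD]
  gcongr
  exact volume_closedTriangle_le

lemma zero_mem_interior_minTriangle {s : ℝ} (hs : 0 < s) (hs1 : s ≤ 1) :
    (0 : E 2) ∈ interior (minTriangle s) := by
  have hD : cross !₂[2 * s, s] !₂[s, 2] ≠ 0 := by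
    rw [cross_minTriangle]; nlinarith
  have ho := (isOpenMap_add_left (!₂[-s, -(s + 2) / 3] : E 2)).comp
    ((frameMap _ _).isOpenMap_of_finiteDimensional (surjective_frameMap hD))
  have hsub : openTriangle ⊆ closedTriangle := fun p hp => ⟨hp.1.le, hp.2.1.le, hp.2.2.le⟩
  refine interior_maximal (Set.image_mono hsub) (ho _ isOpen_openTriangle) ?_
  refine ⟨!₂[1 / 3, 1 / 3], by norm_num [openTriangle], ?_⟩
  ext i
  fin_cases i <;> simp [frameMap_apply] <;> ring

lemma isConvexBody_minTriangle {s : ℝ} (hs : 0 < s) (hs1 : s ≤ 1) :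
    IsConvexBody (minTriangle s) := by
  refine ⟨?_, ?_, ⟨0, zero_mem_interior_minTriangle hs hs1⟩⟩
  · rw [minTriangle, ← Set.image_image (fun q => _ + q)]
    exact (convex_closedTriangle.linear_image (frameMap _ _)).translate _
  · refine isCompact_closedTriangle.image ?_
    exact continuous_const.add (LinearMap.continuous_of_finiteDimensional _)

lemma minTriangle_width_e1_le {s : ℝ} (hs : 0 < s) {a b : E 2} (ha : a ∈ minTriangle s)
    (hb : b ∈ minTriangle s) : a 0 - b 0 ≤ 2 * s := by
  obtain ⟨p, ⟨p0, p1, p2⟩, rfl⟩ := ha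
  obtain ⟨q, ⟨q0, q1, q2⟩, rfl⟩ := hb
  simp [frameMap_apply]
  nlinarith

lemma minTriangle_width_e2_le {s : ℝ} (hs : 0 < s) (hs1 : s ≤ 1) {a b : E 2}
    (ha : a ∈ minTriangle s) (hb : b ∈ minTriangle s) : a 1 - b 1 ≤ 2 := by
  obtain ⟨p, ⟨p0, p1, p2⟩, rfl⟩ := ha
  obtain ⟨q, ⟨q0, q1, q2⟩, rfl⟩ := hb
  simp [frameMap_apply]
  nlinarith

lemma minTriangle_vertex_sub {s : ℝ} {z : E 2} {w : ℝ}
    (h : ∀ a ∈ minTriangle s, ∀ b ∈ minTriangle s, ⟪a - b, z⟫ ≤ w) :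
    |2 * s * z 0 + s * z 1| ≤ w ∧ |s * z 0 + 2 * z 1| ≤ w ∧
      |s * z 0 + (s - 2) * z 1| ≤ w := by
  have m0 : !₂[-s, -(s + 2) / 3] ∈ minTriangle s :=
    ⟨0, by norm_num [closedTriangle], by simp⟩
  have m1 : !₂[-s, -(s + 2) / 3] + !₂[2 * s, s] ∈ minTriangle s :=
    ⟨!₂[1, 0], by norm_num [closedTriangle], by simp [frameMap_apply]⟩
  have m2 : !₂[-s, -(s + 2) / 3] + !₂[s, 2] ∈ minTriangle s :=
    ⟨!₂[0, 1], by norm_num [closedTriangle], by simp [frameMap_apply]⟩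
  have h01 := h _ m0 _ m1
  have h10 := h _ m1 _ m0
  have h02 := h _ m0 _ m2
  have h20 := h _ m2 _ m0
  have h12 := h _ m1 _ m2
  have h21 := h _ m2 _ m1
  simp [PiLp.inner_apply, Fin.sum_univ_two] at h01 h10 h02 h20 h12 h21
  refine ⟨abs_le.2 ⟨?_, ?_⟩, abs_le.2 ⟨?_, ?_⟩, abs_le.2 ⟨?_, ?_⟩⟩ <;> linarith

lemma two_le_minTriangle_width {s : ℝ} (hs : 0 < s) (hs1 : s ≤ 1) {z : E 2} {w : ℝ}
    (hz : isLatticePoint z) (hz1 : z 1 ≠ 0)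
    (h : ∀ a ∈ minTriangle s, ∀ b ∈ minTriangle s, ⟪a - b, z⟫ ≤ w) : 2 ≤ w := by
  obtain ⟨-, h2, h3⟩ := minTriangle_vertex_sub h
  obtain ⟨m, hm⟩ := hz 0
  obtain ⟨n, hn⟩ := hz 1
  rw [hn] at hz1
  rw [hm, hn] at h2 h3
  rw [abs_le] at h2 h3
  have hn0 : n ≠ 0 := by
    rintro rfl
    simp at hz1
  rcases lt_or_gt_of_ne hn0 with hneg | hpos
  · have hn1 : (n : ℝ) ≤ -1 := by exact_mod_cast (by omega : n ≤ -1)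
    rcases le_or_gt m 0 with hm0 | hm0
    · have : (m : ℝ) ≤ 0 := by exact_mod_cast hm0
      nlinarith
    · have : (1 : ℝ) ≤ m := by exact_mod_cast (by omega : 1 ≤ m)
      nlinarith
  · have hn1 : (1 : ℝ) ≤ n := by exact_mod_cast (by omega : 1 ≤ n)
    rcases le_or_gt 0 m with hm0 | hm0
    · have : (0 : ℝ) ≤ m := by exact_mod_cast hm0
      nlinarith
    · have : (m : ℝ) ≤ -1 := by exact_mod_cast (by omega : m ≤ -1)
      nlinarith

lemma le_minTriangle_width {s : ℝ} (hs : 0 < s) (hs1 : s ≤ 1) {z : E 2} {w : ℝ}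
    (hz : isLatticePoint z) (hz0 : z ≠ 0)
    (h : ∀ a ∈ minTriangle s, ∀ b ∈ minTriangle s, ⟪a - b, z⟫ ≤ w) : 2 * s ≤ w := by
  by_cases hz1 : z 1 = 0
  · obtain ⟨h1, -, -⟩ := minTriangle_vertex_sub h
    obtain ⟨m, hm⟩ := hz 0
    have hm0 : m ≠ 0 := by
      rintro rfl
      refine hz0 ?_
      ext i
      fin_cases i <;> simp [hm, hz1]
    have hm1 : (1 : ℝ) ≤ |(m : ℝ)| := by exact_mod_cast Int.one_le_abs hm0
    rw [hz1, hm, mul_zero, add_zero, abs_mul, abs_of_pos (by positivity)] at h1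
    nlinarith
  · linarith [two_le_minTriangle_width hs hs1 hz hz1 h]

lemma succMin_one_minTriangle {s : ℝ} (hs : 0 < s) (hs1 : s ≤ 1) :
    succMin (polarBody (csBody (minTriangle s))) 1 = s := by
  refine IsLeast.csInf_eq ⟨⟨hs, ![e1], ?_, ?_⟩, ?_⟩
  · exact LinearIndependent.of_subsingleton (0 : Fin 1) (by simp [e1])
  · intro j
    fin_cases j
    refine ⟨isLatticePoint_e1, (mem_smul_polarBody_csBody hs _).2 fun a ha b hb => ?_⟩
    simpa [e1, EuclideanSpace.inner_single_right] using minTriangle_width_e1_le hs ha hb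
  · rintro lam ⟨hlam, v, hv, hL⟩
    have := le_minTriangle_width hs hs1 (hL 0).1 (hv.ne_zero 0)
      ((mem_smul_polarBody_csBody hlam _).1 (hL 0).2)
    linarith

lemma succMin_two_minTriangle {s : ℝ} (hs : 0 < s) (hs1 : s ≤ 1) :
    succMin (polarBody (csBody (minTriangle s))) 2 = 1 := by
  refine IsLeast.csInf_eq ⟨⟨one_pos, ![e1, e2], linearIndependent_e1 (by simp [e2]), ?_⟩, ?_⟩
  · intro j
    fin_cases j
    · refine ⟨isLatticePoint_e1, (mem_smul_polarBody_csBody one_pos _).2 fun a ha b hb => ?_⟩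
      have := minTriangle_width_e1_le hs ha hb
      simp [e1, EuclideanSpace.inner_single_right] at this ⊢
      linarith
    · refine ⟨isLatticePoint_e2, (mem_smul_polarBody_csBody one_pos _).2 fun a ha b hb => ?_⟩
      simpa [e2, EuclideanSpace.inner_single_right] using minTriangle_width_e2_le hs hs1 ha hb
  · rintro lam ⟨hlam, v, hv, hL⟩
    by_contra! hlt
    have hz (j : Fin 2) : v j 1 = 0 := by
      by_contra hne
      have := two_le_minTriangle_width hs hs1 (hL j).1 hne
        ((mem_smul_polarBody_csBody hlam _).1 (hL j).2)
      linarith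
    have hv2 : v = ![v 0, v 1] := by
      ext j
      fin_cases j <;> rfl
    rw [hv2, LinearIndependent.pair_iff] at hv
    have := hv (v 1 0) (-(v 0 0)) (by
      ext i
      fin_cases i
      · simp; ring
      · simp [hz])
    refine (hv2 ▸ LinearIndependent.pair_iff.2 hv : LinearIndependent ℝ v).ne_zero 0 ?_
    ext i
    fin_cases i
    · simpa using this.2
    · simpa using hz 0

lemma minTriangle_mem_Aclass {t : ℝ} (ht : 1 ≤ t) : minTriangle (1 / t) ∈ Aclass t := by
  have hs : 0 < 1 / t := by positivity
  have hs1 : 1 / t ≤ 1 := by rw [div_le_one (by linarith)]; exact ht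
  refine ⟨isConvexBody_minTriangle hs hs1, zero_mem_interior_minTriangle hs hs1,
    succMin_one_minTriangle hs hs1, succMin_two_minTriangle hs hs1, ?_, ?_⟩
  · rw [succMin_one_minTriangle hs hs1, mem_smul_polarBody_csBody hs]
    intro a ha b hb
    simpa [e1, EuclideanSpace.inner_single_right] using minTriangle_width_e1_le hs ha hb
  · rw [succMin_two_minTriangle hs hs1, mem_smul_polarBody_csBody one_pos]
    intro a ha b hb
    simpa [e2, EuclideanSpace.inner_single_right] using minTriangle_width_e2_le hs hs1 ha hb

lemma eq_of_add_le_of_sq_le_mul {s p q : ℝ} (hp : 0 ≤ p) (hq : 0 ≤ q)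
    (h : p + q ≤ 2 * s) (hpq : s ^ 2 ≤ p * q) : p = s ∧ q = s := by
  have h1 : (p + q) ^ 2 ≤ (2 * s) ^ 2 := pow_le_pow_left₀ (by linarith) h 2
  have h2 : (p - q) ^ 2 ≤ 0 := by nlinarith
  have h3 : p - q = 0 := pow_eq_zero_iff two_ne_zero |>.1 (le_antisymm h2 (sq_nonneg _))
  have h4 : p = q := by linarith
  subst h4
  have h5 : s ≤ p := abs_le_of_sq_le_sq' (by nlinarith : s ^ 2 ≤ p ^ 2) hp |>.2
  constructor <;> linarith

/-- The vertex `(X, Y)` is lowest and `(u, 2)` is highest in direction `(-1, 1)`. -/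
lemma eq_right_vertex {s r u X Y : ℝ} (hs : 0 < s) (hr : 0 ≤ r) (hY : 0 ≤ Y) (hX : X ≤ 2 * s)
    (hw : Y + u ≤ X) (hmax : 2 * s - r ≤ X - Y)
    (hc : 2 * s * (2 - Y) - r * (u - X) ≤ 4 * s - s ^ 2) : X = 2 * s ∧ Y = r := by
  have hYr : Y ≤ r := by linarith
  have h1 : s ^ 2 ≤ (2 * s - r) * Y := by nlinarith
  have hr2 : 0 ≤ 2 * s - r := by
    by_contra! h
    nlinarith
  have h2 : s ^ 2 ≤ (2 * s - r) * r := h1.trans (by gcongr)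
  obtain ⟨-, rfl⟩ := eq_of_add_le_of_sq_le_mul hr2 hr (by linarith) h2
  have : r ≤ Y := by nlinarith
  constructor <;> linarith

/-- The vertex `(2s, r)` is lowest and `(X, Y)` is highest in direction `(-1, 1)`. -/
lemma eq_top_vertex {s r u X Y : ℝ} (hs : 0 < s) (hs1 : s ≤ 1) (hr : 0 ≤ r) (hr2 : r ≤ 2)
    (hu : 0 ≤ u) (hu2 : u ≤ 2 * s) (hY : Y ≤ 2) (hru : s ^ 2 ≤ r * u)
    (hw : 2 ≤ 2 * s - r - (X - Y))
    (hc : u * (Y - r) - 2 * (X - 2 * s) ≤ 4 * s - s ^ 2) : X = u ∧ Y = 2 := by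
  have h1 : 0 ≤ (2 - u) * (2 * s - X - r) := mul_nonneg (by linarith) (by linarith)
  have h2 : 0 ≤ u * ((Y - r) - (2 - (2 * s - X))) := mul_nonneg hu (by linarith)
  have h3 : 2 * (u + r) - r * u ≤ 4 * s - s ^ 2 := by nlinarith
  have h4 : (2 * (u + r)) ^ 2 ≤ (4 * s - s ^ 2 + r * u) ^ 2 :=
    pow_le_pow_left₀ (by linarith) (by linarith) 2
  have h5 : 0 ≤ (r * u - s ^ 2) * (r * u - s ^ 2 + 8 * s - 16) := by
    nlinarith [sq_nonneg (u - r)]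
  have h6 : r * u ≤ 2 * (2 * s) := mul_le_mul hr2 hu2 hu (by norm_num)
  have h7 : r * u - s ^ 2 + 8 * s - 16 < 0 := by nlinarith
  have h8 : r * u = s ^ 2 := by nlinarith
  obtain ⟨rfl, rfl⟩ := eq_of_add_le_of_sq_le_mul hr hu (s := s) (by linarith) hru
  have h9 : 2 * u - X ≤ u := by nlinarith
  constructor <;> linarith

/-- A quadrilateral in the box `[0, 2s] × [0, 2]` with a vertex at the origin, a vertex on the right
side, a vertex on the top side, and width at least `2` in direction `(1, -1)` has twice its area
exceeding `4s - s²`. -/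
lemma corner_quadrilateral_area {s : ℝ} (hs : 0 < s) (hs1 : s ≤ 1) {x y : Fin 4 → ℝ}
    (hx0 : ∀ i, 0 ≤ x i) (hx : ∀ i, x i ≤ 2 * s) (hy0 : ∀ i, 0 ≤ y i) (hy : ∀ i, y i ≤ 2)
    (hc : ∀ i j k l, (x j - x i) * (y l - y k) - (y j - y i) * (x l - x k) ≤ 4 * s - s ^ 2)
    {o r u d P Q : Fin 4} (hall : ∀ i, i = o ∨ i = r ∨ i = u ∨ i = d)
    (hxo : x o = 0) (hyo : y o = 0) (hxr : x r = 2 * s) (hyu : y u = 2)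
    (hdr : ¬ (x d = x r ∧ y d = y r)) (hdu : ¬ (x d = x u ∧ y d = y u))
    (hext : ∀ α β γ : ℝ, 0 ≤ α → 0 ≤ β → 0 ≤ γ → α + β + γ = 1 →
      x d = α * x o + β * x r + γ * x u → y d = α * y o + β * y r + γ * y u → False)
    (hP : ∀ k, x k - y k ≤ x P - y P)
    (hPQ : 2 ≤ (x P - y P) - (x Q - y Q)) : False := by
  have hs2 : 0 < s ^ 2 := by positivity
  have hru : s ^ 2 ≤ y r * x u := by
    have := hc o r o u
    rw [hxo, hyo, hxr, hyu] at this
    linarith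
  have hr : 0 < y r := (hy0 r).lt_of_ne fun h => by rw [← h] at hru; linarith
  have hu : 0 < x u := (hx0 u).lt_of_ne fun h => by rw [← h] at hru; linarith
  have hX0 := hx0 d
  have hX2 := hx d
  have hY0 := hy0 d
  have hY2 := hy d
  have hr2 := hy r
  have hu2 := hx u
  have hRT : y r + x u ≤ 2 * s → False := by
    intro h
    obtain ⟨h1, h2⟩ := eq_of_add_le_of_sq_le_mul hr.le hu.le h hru
    have hD : 0 < 4 * s - s ^ 2 := by nlinarith
    have hs4 : 4 - s ≠ 0 := by linarith
    have k1 := hc r u o d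
    have k2 := hc u r o d
    have k3 := hc o r d u
    have k4 := hc o u r d
    simp only [hxo, hyo, hxr, hyu, h1, h2, sub_zero] at k1 k2 k3 k4
    refine hext (1 - (2 * x d - s * y d) / (4 * s - s ^ 2)
        - (2 * s * y d - s * x d) / (4 * s - s ^ 2))
      ((2 * x d - s * y d) / (4 * s - s ^ 2)) ((2 * s * y d - s * x d) / (4 * s - s ^ 2))
      ?_ ?_ ?_ (by ring) ?_ ?_
    · rw [sub_sub, ← add_div, sub_nonneg, div_le_one hD]
      linarith
    · exact div_nonneg (by linarith) hD.le
    · exact div_nonneg (by linarith) hD.le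
    · rw [hxo, hxr, h2]; field_simp; ring
    · rw [hyo, hyu, h1]; field_simp; ring
  rcases hall P with rfl | rfl | rfl | rfl <;> rcases hall Q with rfl | rfl | rfl | rfl
  · linarith
  · linarith
  · linarith
  · have h1 : x Q = 0 := by linarith
    have h2 : y Q = 2 := by linarith
    have := hc P r P Q
    simp only [hxo, hyo, hxr, h1, h2] at this
    linarith
  · have : y P = 0 := by linarith
    linarith
  · linarith
  · exact hRT (by linarith)
  · refine hdu ?_
    rw [hyu]
    have h := hc o u P Q
    rw [hxo, hyo, hxr, hyu] at h
    exact eq_top_vertex hs hs1 hr.le hr2 hu.le hu2 hY2 hru (by linarith) (by linarith)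
  · linarith
  · linarith
  · linarith
  · have h1 : x Q = 0 := by linarith
    have h2 : y Q = 2 := by linarith
    have := hc o r o Q
    simp only [hxo, hyo, hxr, h1, h2] at this
    linarith
  · have h1 : x P = 2 * s := by linarith
    have h2 : y P = 0 := by linarith
    have := hc Q P Q u
    simp only [hxo, hyo, hyu, h1, h2] at this
    linarith
  · have h1 : y P = 0 := by linarith
    have h2 : y Q = 2 := by linarith
    have h3 : x P = 2 * s := by linarith
    have := hc o P o Q
    simp only [hxo, hyo, hxr, h1, h2, h3] at this
    linarith
  · refine hdr ?_
    rw [hxr]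
    have h := hc o r P Q
    rw [hxo, hyo, hxr, hyu] at h
    have h' := hP r
    exact eq_right_vertex (u := x Q) hs hr.le hY0 hX2 (by linarith) (by linarith) (by linarith)
  · linarith

/-- A quadrilateral inscribed in the box `[0, 2s] × [0, 2]` with width at least `2` in direction
`(1, -1)` has twice its area exceeding `4s - s²`, provided that both the vertical displacement from
left to right and the horizontal displacement from bottom to top are nonnegative. -/
lemma inscribed_quadrilateral_area {s : ℝ} (hs : 0 < s) (hs1 : s ≤ 1) {x y : Fin 4 → ℝ}
    (hx0 : ∀ i, 0 ≤ x i) (hx : ∀ i, x i ≤ 2 * s) (hy0 : ∀ i, 0 ≤ y i) (hy : ∀ i, y i ≤ 2)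
    (hc : ∀ i j k l, (x j - x i) * (y l - y k) - (y j - y i) * (x l - x k) ≤ 4 * s - s ^ 2)
    (hinj : ∀ i j, i ≠ j → ¬ (x i = x j ∧ y i = y j))
    (hext : ∀ i j k d, i ≠ d → j ≠ d → k ≠ d → ∀ α β γ : ℝ, 0 ≤ α → 0 ≤ β → 0 ≤ γ →
      α + β + γ = 1 → x d = α * x i + β * x j + γ * x k → y d = α * y i + β * y j + γ * y k →
      False)
    {l r b u P Q : Fin 4} (hxl : x l = 0) (hxr : x r = 2 * s) (hyb : y b = 0) (hyu : y u = 2)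
    (hp : y l ≤ y r) (hq : x b ≤ x u)
    (hP : ∀ k, x k - y k ≤ x P - y P) (hQ : ∀ k, x Q - y Q ≤ x k - y k)
    (hPQ : 2 ≤ (x P - y P) - (x Q - y Q)) : False := by
  have hs2 : 0 < s ^ 2 := by positivity
  have hpq : s ^ 2 ≤ (y r - y l) * (x u - x b) := by
    have := hc l r b u
    rw [hxl, hxr, hyb, hyu] at this
    linarith
  have hp' : 0 < y r - y l := (sub_nonneg.2 hp).lt_of_ne fun h => by rw [← h] at hpq; linarith
  have hq' : 0 < x u - x b := (sub_nonneg.2 hq).lt_of_ne fun h => by rw [← h] at hpq; linarith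
  have hlr : l ≠ r := by rintro rfl; linarith
  have hbu : b ≠ u := by rintro rfl; linarith
  have hlu : l ≠ u := by rintro rfl; linarith [hy r]
  have hrb : r ≠ b := by rintro rfl; linarith [hy0 l]
  by_cases hlb : l = b
  · subst hlb
    by_cases hru : r = u
    · subst hru
      have h := hc l r P Q
      rw [hxl, hyb, hxr, hyu] at h
      have h1 : 0 ≤ x P - x Q := by linarith [hy0 P, hy Q]
      nlinarith
    · obtain ⟨d, hdl, hdr, hdu, hall⟩ : ∃ d, l ≠ d ∧ r ≠ d ∧ u ≠ d ∧
          ∀ i, i = l ∨ i = r ∨ i = u ∨ i = d := by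
        clear * - hlr hlu hru
        revert l r u
        decide
      exact corner_quadrilateral_area hs hs1 hx0 hx hy0 hy hc hall hxl hyb hxr hyu
        (hinj d r hdr.symm) (hinj d u hdu.symm) (hext l r u d hdl hdr hdu) hP hPQ
  · by_cases hru : r = u
    · subst hru
      obtain ⟨d, hdl, hdr, hdb, hall⟩ : ∃ d, l ≠ d ∧ r ≠ d ∧ b ≠ d ∧
          ∀ i, i = r ∨ i = l ∨ i = b ∨ i = d := by
        clear * - hlr hlb hrb
        revert l r b
        decide
      refine corner_quadrilateral_area (x := fun i => 2 * s - x i) (y := fun i => 2 - y i)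
        (o := r) (r := l) (u := b) (d := d) (P := Q) (Q := P) hs hs1 (fun i => by linarith [hx i])
        (fun i => by linarith [hx0 i]) (fun i => by linarith [hy i]) (fun i => by linarith [hy0 i])
        (fun i j k m => ?_) hall (by simp [hxr]) (by simp [hyu]) (by simp [hxl]) (by simp [hyb])
        (fun h => hinj d l hdl.symm ⟨by linarith [h.1], by linarith [h.2]⟩)
        (fun h => hinj d b hdb.symm ⟨by linarith [h.1], by linarith [h.2]⟩)
        (fun α β γ hα hβ hγ h h1 h2 => hext r l b d hdr hdl hdb α β γ hα hβ hγ h ?_ ?_)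
        (fun k => by linarith [hQ k]) (by linarith)
      · linarith [hc i j k m]
      · linear_combination -h1 - 2 * s * h
      · linear_combination -h2 - 2 * h
    · have hall : ∀ i, i = l ∨ i = r ∨ i = b ∨ i = u := by
        clear * - hlr hlb hrb hlu hbu hru
        revert l r b u
        decide
      have hRT : y r + x u ≤ 2 * s → False := by
        intro h
        obtain ⟨h1, h2⟩ := eq_of_add_le_of_sq_le_mul hp'.le hq'.le
          (by linarith [hy0 l, hx0 b]) hpq
        refine hinj l b hlb ⟨?_, ?_⟩ <;> linarith [hy0 l, hx0 b]
      have hLB : 2 ≤ y l + x b → False := by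
        intro h
        obtain ⟨h1, h2⟩ := eq_of_add_le_of_sq_le_mul (s := s) hp'.le hq'.le
          (by linarith [hy r, hx u]) hpq
        refine hinj r u hru ⟨?_, ?_⟩ <;> linarith [hy r, hx u]
      have := hy r
      have := hx u
      have := hy0 l
      have := hx0 b
      rcases hall P with rfl | rfl | rfl | rfl <;> rcases hall Q with rfl | rfl | rfl | rfl <;>
        first
        | linarith
        | exact hRT (by linarith)
        | exact hLB (by linarith)

/-- The maximal and minimal vertices in a lattice direction not parallel to `e1` differ by at
least two. -/
lemma Aclass.exists_width_ge {t : ℝ} (ht : 1 ≤ t) {w : Fin 4 → E 2}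
    (hK : convexHull ℝ (Set.range w) ∈ Aclass t) (m n : ℤ) (hn : n ≠ 0) :
    ∃ i j, (∀ k, w k 0 * m + w k 1 * n ≤ w i 0 * m + w i 1 * n) ∧
      (∀ k, w j 0 * m + w j 1 * n ≤ w k 0 * m + w k 1 * n) ∧
      2 ≤ (w i 0 * m + w i 1 * n) - (w j 0 * m + w j 1 * n) := by
  have hf (p : E 2) : innerₗ (E 2) !₂[(m : ℝ), (n : ℝ)] p = p 0 * m + p 1 * n := by
    simp [PiLp.inner_apply, Fin.sum_univ_two]
  obtain ⟨i, j, hi, hj, hw⟩ := exists_width_points w (innerₗ (E 2) !₂[(m : ℝ), (n : ℝ)])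
  simp only [hf] at hi hj hw
  refine ⟨i, j, hi, hj, ?_⟩
  by_contra! hlt
  set W := (w i 0 * m + w i 1 * n) - (w j 0 * m + w j 1 * n)
  have h1 : 1 ≤ max (W / 2) (1 / 2) := by
    refine Aclass.one_le_of_width ht hK (lt_max_of_lt_right (by norm_num))
      (isLatticePoint_pair m n) (by simpa using hn) fun a ha b hb => ?_
    have h2 := hw a ha b hb
    have h3 : ⟪a - b, !₂[(m : ℝ), (n : ℝ)]⟫ = (a - b) 0 * m + (a - b) 1 * n := by
      rw [real_inner_comm]; exact hf _
    rw [h3]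
    linarith [le_max_left (W / 2) (1 / 2)]
  rcases le_max_iff.1 h1 with h | h <;> linarith

lemma Aclass.exists_width_e1 {t : ℝ} (ht : 1 ≤ t) {w : Fin 4 → E 2}
    (hK : convexHull ℝ (Set.range w) ∈ Aclass t) :
    ∃ i j, (∀ k, w k 0 ≤ w i 0) ∧ (∀ k, w j 0 ≤ w k 0) ∧ w i 0 - w j 0 = 2 * (1 / t) := by
  obtain ⟨i, j, hi, hj, hw⟩ := exists_width_points w
    (EuclideanSpace.proj 0 : E 2 →L[ℝ] ℝ).toLinearMap
  refine ⟨i, j, hi, hj, le_antisymm (Aclass.width_e1_le ht hK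
    (subset_convexHull ℝ _ ⟨i, rfl⟩) (subset_convexHull ℝ _ ⟨j, rfl⟩)) ?_⟩
  by_contra! hlt
  have hs : 0 < 1 / t := by positivity
  have h1 : 1 / t ≤ max ((w i 0 - w j 0) / 2) (1 / t / 2) := by
    refine Aclass.le_of_width_e1 hK (lt_max_of_lt_right (by positivity)) fun a ha b hb => ?_
    have h2 : a 0 - b 0 ≤ w i 0 - w j 0 := hw a ha b hb
    linarith [le_max_left ((w i 0 - w j 0) / 2) (1 / t / 2)]
  rcases le_max_iff.1 h1 with h | h <;> linarith

/-- An extreme point is not a convex combination of three other points. -/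
lemma extreme_ne_combination {K : Set (E 2)} (hK : Convex ℝ K) {a b c d : E 2}
    (hd : d ∈ Set.extremePoints ℝ K) (ha : a ∈ K) (hb : b ∈ K) (hc : c ∈ K)
    (had : a ≠ d) (hbd : b ≠ d) (hcd : c ≠ d) {α β γ : ℝ} (hα : 0 ≤ α) (hβ : 0 ≤ β) (hγ : 0 ≤ γ)
    (hsum : α + β + γ = 1) : d ≠ α • a + β • b + γ • c := by
  intro h
  refine ((hK.mem_extremePoints_iff_mem_sdiff_convexHull_sdiff).1 hd).2 ?_
  have hsub := subset_convexHull ℝ (K \ {d})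
  have := (convex_convexHull ℝ (K \ {d})).sum_mem (t := Finset.univ) (w := ![α, β, γ])
    (z := ![a, b, c])
    (by intro i _; fin_cases i <;> simpa)
    (by simpa [Fin.sum_univ_three])
    (by
      intro i _
      fin_cases i
      · exact hsub ⟨ha, had⟩
      · exact hsub ⟨hb, hbd⟩
      · exact hsub ⟨hc, hcd⟩)
  simpa [Fin.sum_univ_three, ← h] using this

lemma Mclass.cross_le {t : ℝ} (ht : 1 ≤ t) {K : Set (E 2)} (hK : K ∈ Mclass t) {a b c d : E 2}
    (ha : a ∈ K) (hb : b ∈ K) (hc : c ∈ K) (hd : d ∈ K) :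
    |cross (b - a) (d - c)| ≤ 4 * (1 / t) - (1 / t) ^ 2 := by
  have hs : 0 < 1 / t := by positivity
  have hs1 : 1 / t ≤ 1 := by rw [div_le_one (by linarith)]; exact ht
  have h := ((cross_chords_le hK.1.1.1 ha hb hc hd).trans
    (hK.2 _ (minTriangle_mem_Aclass ht))).trans (volume_minTriangle_le hs hs1)
  rw [ENNReal.ofReal_le_ofReal_iff (by nlinarith)] at h
  linarith

theorem no_quadrilateral_minimizer (t : ℝ) (ht : 1 ≤ t) (K : Set (E 2))
    (hK : K ∈ Mclass t) :
    ¬ ∃ V : Finset (E 2), V.card = 4 ∧ (V : Set (E 2)) = Set.extremePoints ℝ K ∧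
        K = convexHull ℝ (V : Set (E 2)) := by
  rintro ⟨V, hcard, hV, hKV⟩
  let e := (V.equivFinOfCardEq hcard).symm
  let w : Fin 4 → E 2 := fun i => e i
  have hw : Set.range w = V := by
    ext p
    constructor
    · rintro ⟨i, rfl⟩
      exact (e i).2
    · intro hp
      exact ⟨e.symm ⟨p, hp⟩, by simp [w]⟩
  have hwinj : Function.Injective w := Subtype.val_injective.comp e.injective
  have hwK (i : Fin 4) : w i ∈ K := by
    rw [hKV]
    exact subset_convexHull ℝ _ (e i).2
  have hwext (i : Fin 4) : w i ∈ Set.extremePoints ℝ K := by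
    rw [← hV]
    exact (e i).2
  have hA : convexHull ℝ (Set.range w) ∈ Aclass t := by
    rw [hw, ← hKV]
    exact hK.1
  have hs : 0 < 1 / t := by positivity
  have hs1 : 1 / t ≤ 1 := by rw [div_le_one (by linarith)]; exact ht
  obtain ⟨r, l, hr, hl, hrl⟩ := Aclass.exists_width_e1 ht hA
  obtain ⟨u, b, hu, hb, hub⟩ := Aclass.exists_width_ge ht hA 0 1 one_ne_zero
  obtain ⟨P, Q, hP, hQ, hPQ⟩ := Aclass.exists_width_ge ht hA 1 (-1) (by norm_num)
  obtain ⟨P', Q', hP', hQ', hPQ'⟩ := Aclass.exists_width_ge ht hA 1 1 one_ne_zero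
  simp only [Int.cast_zero, Int.cast_one, Int.cast_neg, mul_zero, mul_one, zero_add,
    mul_neg] at hu hb hub hP hQ hPQ hP' hQ' hPQ'
  have hub' : w u 1 - w b 1 = 2 :=
    le_antisymm (Aclass.width_e2_le hK.1 (hwK u) (hwK b)) hub
  have hc (i j k m : Fin 4) : |(w j 0 - w i 0) * (w m 1 - w k 1) -
      (w j 1 - w i 1) * (w m 0 - w k 0)| ≤ 4 * (1 / t) - (1 / t) ^ 2 :=
    Mclass.cross_le ht hK (hwK i) (hwK j) (hwK k) (hwK m)
  have hinj (i j : Fin 4) (hij : i ≠ j) : ¬ (w i 0 = w j 0 ∧ w i 1 = w j 1) := by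
    rintro ⟨h0, h1⟩
    refine hij (hwinj ?_)
    ext k
    fin_cases k
    · exact h0
    · exact h1
  have hext (i j k d : Fin 4) (hi : i ≠ d) (hj : j ≠ d) (hk : k ≠ d) (α β γ : ℝ) (hα : 0 ≤ α)
      (hβ : 0 ≤ β) (hγ : 0 ≤ γ) (hsum : α + β + γ = 1)
      (h0 : w d 0 = α * w i 0 + β * w j 0 + γ * w k 0)
      (h1 : w d 1 = α * w i 1 + β * w j 1 + γ * w k 1) : False := by
    refine extreme_ne_combination hK.1.1.1 (hwext d) (hwK i) (hwK j) (hwK k) (hwinj.ne hi)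
      (hwinj.ne hj) (hwinj.ne hk) hα hβ hγ hsum ?_
    ext m
    fin_cases m
    · simpa using h0
    · simpa using h1
  generalize 1 / t = s at *
  have hpq : s ^ 2 ≤ (w r 1 - w l 1) * (w u 0 - w b 0) := by
    have := (abs_le.1 (hc l r b u)).2
    rw [hrl, hub'] at this
    linarith
  have hs2 : 0 < s ^ 2 := by positivity
  rcases mul_pos_iff.1 (hs2.trans_le hpq) with ⟨hp, hq⟩ | ⟨hp, hq⟩
  · refine inscribed_quadrilateral_area (x := fun i => w i 0 - w l 0) (y := fun i => w i 1 - w b 1)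
      (l := l) (r := r) (b := b) (u := u) (P := P) (Q := Q) hs hs1 (fun i => by linarith [hl i])
      (fun i => by linarith [hr i]) (fun i => by linarith [hb i]) (fun i => by linarith [hu i])
      (fun i j k m => by linarith [(abs_le.1 (hc i j k m)).2])
      (fun i j hij h => hinj i j hij ⟨by linarith [h.1], by linarith [h.2]⟩)
      (fun i j k d hi hj hk α β γ hα hβ hγ h h0 h1 =>
        hext i j k d hi hj hk α β γ hα hβ hγ h ?_ ?_)
      (sub_self _) hrl (sub_self _) hub' (by linarith) (by linarith)
      (fun k => by linarith [hP k]) (fun k => by linarith [hQ k]) (by linarith)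
    · linear_combination h0 - w l 0 * h
    · linear_combination h1 - w b 1 * h
  · refine inscribed_quadrilateral_area (x := fun i => w i 0 - w l 0) (y := fun i => w u 1 - w i 1)
      (l := l) (r := r) (b := u) (u := b) (P := P') (Q := Q') hs hs1 (fun i => by linarith [hl i])
      (fun i => by linarith [hr i]) (fun i => by linarith [hu i]) (fun i => by linarith [hb i])
      (fun i j k m => by linarith [(abs_le.1 (hc i j k m)).1])
      (fun i j hij h => hinj i j hij ⟨by linarith [h.1], by linarith [h.2]⟩)
      (fun i j k d hi hj hk α β γ hα hβ hγ h h0 h1 =>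
        hext i j k d hi hj hk α β γ hα hβ hγ h ?_ ?_)
      (sub_self _) hrl (sub_self _) hub' (by linarith) (by linarith)
      (fun k => by linarith [hP' k]) (fun k => by linarith [hQ' k]) (by linarith)
    · linear_combination h0 - w l 0 * h
    · linear_combination -h1 - w u 1 * h
end
end
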